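/- Logarithmic uncertainty principle for the GQFT: let φ ∈ S(ℝ², ℍ) be a nonzero quaternion window function and f ∈ S(ℝ², ℍ). Then ∥φ∥₂² ∫_{ℝ²} ln|x| |f(x)|² dx + ∫_{ℝ²} ∫_{ℝ²} ln|ω| |G_φ f(ω, b)|² dω db ≥ ∥φ∥₂² (ψ(1/2) − ln π) ∫_{ℝ²} |f(x)|² dx, where ψ = Γ'/Γ is the digamma function. -/

import Mathlib

open MeasureTheory Real

noncomputable section

/-- The quaternion exponential `e^{iθ} = cos θ + i sin θ`. -/
def expI (θ : ℝ) : Quaternion ℝ := ⟨Real.cos θ, Real.sin θ, 0, 0⟩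

/-- The quaternion exponential `e^{jθ} = cos θ + j sin θ`. -/
def expJ (θ : ℝ) : Quaternion ℝ := ⟨Real.cos θ, 0, Real.sin θ, 0⟩

/-- The two-sided quaternionic Fourier transform
`F_q f (ω) = ∫ e^{-2π i x₁ ω₁} f(x) e^{-2π j x₂ ω₂} dx`. -/
def QFT (f : ℝ × ℝ → Quaternion ℝ) (ω : ℝ × ℝ) : Quaternion ℝ :=
  ∫ x : ℝ × ℝ, expI (-(2 * π * x.1 * ω.1)) * f x * expJ (-(2 * π * x.2 * ω.2))

/-- The two-sided Gabor quaternionic Fourier transform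
`G_φ f (ω, b) = ∫ e^{-2π i x₁ ω₁} f(x) conj(φ(x - b)) e^{-2π j x₂ ω₂} dx`. -/
def GQFT (φ f : ℝ × ℝ → Quaternion ℝ) (ω b : ℝ × ℝ) : Quaternion ℝ :=
  ∫ x : ℝ × ℝ,
    expI (-(2 * π * x.1 * ω.1)) * (f x * star (φ (x - b))) * expJ (-(2 * π * x.2 * ω.2))

/-- The `k`-th coordinate of a point of `ℝ²`. -/
def coord : Fin 2 → ℝ × ℝ → ℝ
  | 0 => Prod.fst
  | 1 => Prod.snd

/-- The `k`-th standard basis direction of `ℝ²`. -/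
def dirv : Fin 2 → ℝ × ℝ
  | 0 => (1, 0)
  | 1 => (0, 1)

/-- The Euclidean norm on `ℝ²`. -/
def euclNorm (x : ℝ × ℝ) : ℝ := Real.sqrt (x.1 ^ 2 + x.2 ^ 2)

lemma gauss_exp (t : ℝ) (ht : 0 < t) (s : ℝ) :
    ∫ ω : ℝ, Complex.exp (Complex.I * (2 * π * s : ℝ) * ω) * Complex.exp (-(π * t : ℝ) * ω ^ 2) =
      ((1 / √t * Real.exp (-(π * s ^ 2 / t)) : ℝ) : ℂ) := by
  have h := fourierIntegral_gaussian (b := ((π * t : ℝ) : ℂ)) (by simpa using by positivity)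
    ((2 * π * s : ℝ) : ℂ)
  rw [h]
  have h1 : (π : ℂ) / ((π * t : ℝ) : ℂ) = ((1 / t : ℝ) : ℂ) := by
    push_cast
    have : (π : ℂ) ≠ 0 := by exact_mod_cast pi_ne_zero
    have : (t : ℂ) ≠ 0 := by exact_mod_cast ht.ne'
    field_simp
  rw [h1]
  have h2 : (((1 / t : ℝ) : ℂ)) ^ (1 / 2 : ℂ) = ((1 / √t : ℝ) : ℂ) := by
    have := Complex.ofReal_cpow (x := 1 / t) (by positivity) (1 / 2)
    rw [← Real.sqrt_eq_rpow, Real.sqrt_div zero_le_one, Real.sqrt_one] at this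
    rw [this]; push_cast; rfl
  rw [h2, Complex.ofReal_mul (1 / √t), Complex.ofReal_exp]
  congr 2
  push_cast
  have : (π : ℂ) ≠ 0 := by exact_mod_cast pi_ne_zero
  have : (t : ℂ) ≠ 0 := by exact_mod_cast ht.ne'
  field_simp
  ring

lemma gauss_integrable (t : ℝ) (ht : 0 < t) :
    Integrable (fun ω : ℝ => Real.exp (-(π * t * ω ^ 2))) := by
  have := integrable_exp_neg_mul_sq (b := π * t) (by positivity)
  simpa [neg_mul] using this

lemma gauss_integrable_mul (t : ℝ) (ht : 0 < t) (g : ℝ → ℝ) (hg : Continuous g)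
    (hb : ∀ x, |g x| ≤ 1) :
    Integrable (fun ω : ℝ => g ω * Real.exp (-(π * t * ω ^ 2))) := by
  refine (gauss_integrable t ht).bdd_mul (c := 1) hg.aestronglyMeasurable ?_
  filter_upwards with x using by simpa using hb x

lemma gauss_cos (t : ℝ) (ht : 0 < t) (s : ℝ) :
    ∫ ω : ℝ, Real.cos (2 * π * s * ω) * Real.exp (-(π * t * ω ^ 2)) =
      1 / √t * Real.exp (-(π * s ^ 2 / t)) := by
  have h := congrArg Complex.re (gauss_exp t ht s)
  rw [Complex.ofReal_re] at h
  rw [← h]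
  have hi : Integrable (fun ω : ℝ => Complex.exp (Complex.I * (2 * π * s : ℝ) * ω) *
      Complex.exp (-(π * t : ℝ) * ω ^ 2)) := by
    have := GaussianFourier.integrable_cexp_neg_mul_sq_add_real_mul_I (b := ((π * t : ℝ) : ℂ))
       (by simpa using by positivity) 0
    have h2 := integrable_cexp_quadratic (b := ((π * t : ℝ) : ℂ)) (by simpa using by positivity)
      (Complex.I * (2 * π * s : ℝ)) 0
    refine h2.congr ?_
    filter_upwards with x
    rw [← Complex.exp_add]; congr 1; ring
  have := integral_re hi
  simp only [RCLike.re_eq_complex_re] at this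
  rw [← this]
  congr 1; ext ω
  rw [show Complex.I * (2 * π * s : ℝ) * ω = ((2 * π * s * ω : ℝ) : ℂ) * Complex.I by
    push_cast; ring, show -((π * t : ℝ) : ℂ) * (ω : ℂ) ^ 2 = ((-(π * t * ω ^ 2) : ℝ) : ℂ) by
    push_cast; ring, ← Complex.ofReal_exp, Complex.re_mul_ofReal, Complex.exp_ofReal_mul_I_re]

lemma gauss_sin (t : ℝ) (s : ℝ) :
    ∫ ω : ℝ, Real.sin (2 * π * s * ω) * Real.exp (-(π * t * ω ^ 2)) = 0 := by
  have h := integral_neg_eq_self (fun ω : ℝ => Real.sin (2 * π * s * ω) * Real.exp (-(π * t * ω ^ 2)))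
    volume
  simp only [mul_neg, Real.sin_neg, neg_sq, neg_mul] at h
  rw [integral_neg] at h
  linarith

lemma expI_norm (θ : ℝ) : ‖expI θ‖ = 1 := by
  have h : ‖expI θ‖ * ‖expI θ‖ = 1 := by
    rw [← Quaternion.normSq_eq_norm_mul_self, Quaternion.normSq_def']
    simp [expI]
  nlinarith [norm_nonneg (expI θ)]

lemma expJ_norm (θ : ℝ) : ‖expJ θ‖ = 1 := by
  have h : ‖expJ θ‖ * ‖expJ θ‖ = 1 := by
    rw [← Quaternion.normSq_eq_norm_mul_self, Quaternion.normSq_def']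
    simp [expJ]
  nlinarith [norm_nonneg (expJ θ)]

/-- unit quaternions -/
def qI : Quaternion ℝ := ⟨0, 1, 0, 0⟩
/-- unit quaternions -/
def qJ : Quaternion ℝ := ⟨0, 0, 1, 0⟩

@[simp] lemma expI_re (θ : ℝ) : (expI θ).re = Real.cos θ := rfl
@[simp] lemma expI_imI (θ : ℝ) : (expI θ).imI = Real.sin θ := rfl
@[simp] lemma expI_imJ (θ : ℝ) : (expI θ).imJ = 0 := rfl
@[simp] lemma expI_imK (θ : ℝ) : (expI θ).imK = 0 := rfl
@[simp] lemma expJ_re (θ : ℝ) : (expJ θ).re = Real.cos θ := rfl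
@[simp] lemma expJ_imI (θ : ℝ) : (expJ θ).imI = 0 := rfl
@[simp] lemma expJ_imJ (θ : ℝ) : (expJ θ).imJ = Real.sin θ := rfl
@[simp] lemma expJ_imK (θ : ℝ) : (expJ θ).imK = 0 := rfl
@[simp] lemma qI_re : (qI).re = 0 := rfl
@[simp] lemma qI_imI : (qI).imI = 1 := rfl
@[simp] lemma qI_imJ : (qI).imJ = 0 := rfl
@[simp] lemma qI_imK : (qI).imK = 0 := rfl
@[simp] lemma qJ_re : (qJ).re = 0 := rfl
@[simp] lemma qJ_imI : (qJ).imI = 0 := rfl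
@[simp] lemma qJ_imJ : (qJ).imJ = 1 := rfl
@[simp] lemma qJ_imK : (qJ).imK = 0 := rfl

lemma expI_eq (θ : ℝ) : expI θ = Real.cos θ • (1 : Quaternion ℝ) + Real.sin θ • qI := by
  ext <;> simp [Quaternion.re_one, Quaternion.imI_one, Quaternion.imJ_one, Quaternion.imK_one]
lemma expJ_eq (θ : ℝ) : expJ θ = Real.cos θ • (1 : Quaternion ℝ) + Real.sin θ • qJ := by
  ext <;> simp [Quaternion.re_one, Quaternion.imI_one, Quaternion.imJ_one, Quaternion.imK_one]

lemma expI_cont : Continuous expI := by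
  have : expI = fun θ => Real.cos θ • (1 : Quaternion ℝ) + Real.sin θ • qI := funext expI_eq
  rw [this]; fun_prop
lemma expJ_cont : Continuous expJ := by
  have : expJ = fun θ => Real.cos θ • (1 : Quaternion ℝ) + Real.sin θ • qJ := funext expJ_eq
  rw [this]; fun_prop

lemma inner_phase (a b : Quaternion ℝ) (p q r s : ℝ) :
    inner ℝ (expI (-p) * a * expJ (-q)) (expI (-r) * b * expJ (-s)) =
     Real.cos (r - p) * Real.cos (s - q) * inner ℝ a b
     + Real.sin (r - p) * Real.cos (s - q) * inner ℝ (qI * a) b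
     + Real.cos (r - p) * Real.sin (s - q) * inner ℝ (a * qJ) b
     + Real.sin (r - p) * Real.sin (s - q) * inner ℝ (qI * a * qJ) b := by
  simp only [Quaternion.inner_def, Real.cos_sub, Real.sin_sub]
  simp [Quaternion.re_mul, Quaternion.imI_mul, Quaternion.imJ_mul, Quaternion.imK_mul]
  ring

/-- heat kernel -/
def gk (t : ℝ) (x y : ℝ × ℝ) : ℝ :=
  1 / t * Real.exp (-(π * ((x.1 - y.1) ^ 2 + (x.2 - y.2) ^ 2) / t))

lemma gk_cont (t : ℝ) : Continuous (fun p : (ℝ × ℝ) × (ℝ × ℝ) => gk t p.1 p.2) := by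
  unfold gk; fun_prop

lemma gk_nonneg (t : ℝ) (ht : 0 < t) (x y) : 0 ≤ gk t x y := by
  unfold gk; positivity

lemma gk_symm (t : ℝ) (x y) : gk t x y = gk t y x := by
  unfold gk; congr 4; ring

lemma gk_le (t : ℝ) (ht : 0 < t) (x y) : gk t x y ≤ 1 / t := by
  unfold gk
  have : Real.exp (-(π * ((x.1 - y.1) ^ 2 + (x.2 - y.2) ^ 2) / t)) ≤ 1 := by
    rw [Real.exp_le_one_iff]
    have : 0 ≤ π * ((x.1 - y.1) ^ 2 + (x.2 - y.2) ^ 2) / t := by positivity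
    linarith
  have h2 : 0 < 1 / t := by positivity
  nlinarith

lemma inner_prod_integrable (u : ℝ × ℝ → Quaternion ℝ) (hu : Integrable u) :
    Integrable (fun p : (ℝ × ℝ) × (ℝ × ℝ) => inner ℝ (u p.1) (u p.2)) := by
  have h1 := (hu.norm.mul_prod hu.norm)
  refine h1.mono ?_ ?_
  · exact (hu.1.comp_fst).inner (hu.1.comp_snd)
  · filter_upwards with p
    refine (norm_inner_le_norm _ _).trans ?_
    simp

lemma inner_prod_integral (u : ℝ × ℝ → Quaternion ℝ) (hu : Integrable u) :
    ∫ p : (ℝ × ℝ) × (ℝ × ℝ), (inner ℝ (u p.1) (u p.2) : ℝ) = ‖∫ x, u x‖ ^ 2 := by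
  have := integral_prod _ (inner_prod_integrable u hu)
  rw [Measure.volume_eq_prod, this]
  simp only
  have h2 : ∀ x, ∫ y, (inner ℝ (u x) (u y) : ℝ) = inner ℝ (u x) (∫ y, u y) := fun x =>
    integral_inner hu _
  simp only [h2]
  have h3 : ∀ x, (inner ℝ (u x) (∫ y, u y) : ℝ) = inner ℝ (∫ y, u y) (u x) := fun x =>
    real_inner_comm _ _
  simp only [h3]
  rw [integral_inner hu, real_inner_self_eq_norm_sq]

lemma phase_integrable (h : ℝ × ℝ → Quaternion ℝ) (hc : Continuous h) (hi : Integrable h)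
    (ω : ℝ × ℝ) : Integrable (fun x : ℝ × ℝ =>
      expI (-(2 * π * x.1 * ω.1)) * h x * expJ (-(2 * π * x.2 * ω.2))) := by
  have c1 := expI_cont
  have c2 := expJ_cont
  refine hi.mono (by fun_prop) ?_
  filter_upwards with x
  rw [norm_mul, norm_mul, expI_norm, expJ_norm]; simp

lemma gauss2_integrable (t : ℝ) (ht : 0 < t) :
    Integrable (fun ω : ℝ × ℝ => Real.exp (-(π * t * (ω.1 ^ 2 + ω.2 ^ 2)))) := by
  have := (gauss_integrable t ht).mul_prod (gauss_integrable t ht)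
  refine this.congr ?_
  filter_upwards with x
  rw [← Real.exp_add]; congr 1; ring

lemma integral_add4 (f g h k : ℝ × ℝ → ℝ) (hf : Integrable f) (hg : Integrable g)
    (hh : Integrable h) (hk : Integrable k) :
    ∫ x, (f x + g x + h x + k x) = (∫ x, f x) + (∫ x, g x) + (∫ x, h x) + ∫ x, k x := by
  have i2 : Integrable (fun x => f x + g x) := hf.add hg
  have i3 : Integrable (fun x => f x + g x + h x) := i2.add hh
  rw [integral_add i3 hk, integral_add i2 hh, integral_add hf hg]

lemma gauss_phase (t : ℝ) (ht : 0 < t) (a b : Quaternion ℝ) (x y : ℝ × ℝ) :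
    ∫ ω : ℝ × ℝ, Real.exp (-(π * t * (ω.1 ^ 2 + ω.2 ^ 2))) *
      inner ℝ (expI (-(2 * π * x.1 * ω.1)) * a * expJ (-(2 * π * x.2 * ω.2)))
        (expI (-(2 * π * y.1 * ω.1)) * b * expJ (-(2 * π * y.2 * ω.2))) =
    inner ℝ a b * gk t x y := by
  have key : ∀ f g : ℝ → ℝ, Continuous f → Continuous g → (∀ x, |f x| ≤ 1) → (∀ x, |g x| ≤ 1) →
      ∀ c : ℝ, Integrable (fun ω : ℝ × ℝ => (f ω.1 * Real.exp (-(π * t * ω.1 ^ 2))) *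
        (g ω.2 * Real.exp (-(π * t * ω.2 ^ 2))) * c) := by
    intro f g hf hg hf1 hg1 c
    exact ((gauss_integrable_mul t ht f hf hf1).mul_prod
      (gauss_integrable_mul t ht g hg hg1)).mul_const c
  have hcos : ∀ s : ℝ, Continuous (fun w : ℝ => Real.cos (2 * π * s * w)) := by intro s; fun_prop
  have hsin : ∀ s : ℝ, Continuous (fun w : ℝ => Real.sin (2 * π * s * w)) := by intro s; fun_prop
  have bcos : ∀ s x : ℝ, |(fun w : ℝ => Real.cos (2 * π * s * w)) x| ≤ 1 :=
    fun s x => Real.abs_cos_le_one _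
  have bsin : ∀ s x : ℝ, |(fun w : ℝ => Real.sin (2 * π * s * w)) x| ≤ 1 :=
    fun s x => Real.abs_sin_le_one _
  set s1 := y.1 - x.1
  set s2 := y.2 - x.2
  have k1 := key _ _ (hcos s1) (hcos s2) (bcos s1) (bcos s2) (inner ℝ a b)
  have k2 := key _ _ (hsin s1) (hcos s2) (bsin s1) (bcos s2) (inner ℝ (qI * a) b)
  have k3 := key _ _ (hcos s1) (hsin s2) (bcos s1) (bsin s2) (inner ℝ (a * qJ) b)
  have k4 := key _ _ (hsin s1) (hsin s2) (bsin s1) (bsin s2) (inner ℝ (qI * a * qJ) b)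
  have e : ∀ ω : ℝ × ℝ, Real.exp (-(π * t * (ω.1 ^ 2 + ω.2 ^ 2))) *
      (inner ℝ (expI (-(2 * π * x.1 * ω.1)) * a * expJ (-(2 * π * x.2 * ω.2)))
        (expI (-(2 * π * y.1 * ω.1)) * b * expJ (-(2 * π * y.2 * ω.2))) : ℝ) =
      ((Real.cos (2 * π * s1 * ω.1) * Real.exp (-(π * t * ω.1 ^ 2))) *
        (Real.cos (2 * π * s2 * ω.2) * Real.exp (-(π * t * ω.2 ^ 2))) * inner ℝ a b) +
      ((Real.sin (2 * π * s1 * ω.1) * Real.exp (-(π * t * ω.1 ^ 2))) *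
        (Real.cos (2 * π * s2 * ω.2) * Real.exp (-(π * t * ω.2 ^ 2))) * inner ℝ (qI * a) b) +
      ((Real.cos (2 * π * s1 * ω.1) * Real.exp (-(π * t * ω.1 ^ 2))) *
        (Real.sin (2 * π * s2 * ω.2) * Real.exp (-(π * t * ω.2 ^ 2))) * inner ℝ (a * qJ) b) +
      ((Real.sin (2 * π * s1 * ω.1) * Real.exp (-(π * t * ω.1 ^ 2))) *
        (Real.sin (2 * π * s2 * ω.2) * Real.exp (-(π * t * ω.2 ^ 2))) *
          inner ℝ (qI * a * qJ) b) := by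
    intro ω
    rw [inner_phase, show 2 * π * y.1 * ω.1 - 2 * π * x.1 * ω.1 = 2 * π * s1 * ω.1 by
      simp only [s1]; ring, show 2 * π * y.2 * ω.2 - 2 * π * x.2 * ω.2 = 2 * π * s2 * ω.2 by
      simp only [s2]; ring, show -(π * t * (ω.1 ^ 2 + ω.2 ^ 2)) = -(π * t * ω.1 ^ 2) +
      -(π * t * ω.2 ^ 2) by ring, Real.exp_add]
    ring
  have P : ∀ (f g : ℝ → ℝ), ∫ ω : ℝ × ℝ, f ω.1 * g ω.2 = (∫ x, f x) * ∫ x, g x := fun f g =>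
    integral_prod_mul f g
  have st : 1 / √t * (1 / √t) = 1 / t := by
    rw [div_mul_div_comm, Real.mul_self_sqrt ht.le, one_mul]
  rw [integral_congr_ae (Filter.Eventually.of_forall e), integral_add4 _ _ _ _ k1 k2 k3 k4]
  simp only [integral_mul_const]
  rw [P (fun w => Real.cos (2 * π * s1 * w) * Real.exp (-(π * t * w ^ 2)))
      (fun w => Real.cos (2 * π * s2 * w) * Real.exp (-(π * t * w ^ 2))),
    P (fun w => Real.sin (2 * π * s1 * w) * Real.exp (-(π * t * w ^ 2)))
      (fun w => Real.cos (2 * π * s2 * w) * Real.exp (-(π * t * w ^ 2))),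
    P (fun w => Real.cos (2 * π * s1 * w) * Real.exp (-(π * t * w ^ 2)))
      (fun w => Real.sin (2 * π * s2 * w) * Real.exp (-(π * t * w ^ 2))),
    P (fun w => Real.sin (2 * π * s1 * w) * Real.exp (-(π * t * w ^ 2)))
      (fun w => Real.sin (2 * π * s2 * w) * Real.exp (-(π * t * w ^ 2))),
    gauss_cos t ht, gauss_cos t ht, gauss_sin, gauss_sin]
  unfold gk
  rw [show -(π * ((x.1 - y.1) ^ 2 + (x.2 - y.2) ^ 2) / t) = -(π * s1 ^ 2 / t) + -(π * s2 ^ 2 / t) by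
    simp only [s1, s2]; ring, Real.exp_add, ← st]
  ring

lemma energy_eq (h : ℝ × ℝ → Quaternion ℝ) (hc : Continuous h) (hi : Integrable h)
    (t : ℝ) (ht : 0 < t) :
    ∫ ω : ℝ × ℝ, Real.exp (-(π * t * (ω.1 ^ 2 + ω.2 ^ 2))) * ‖QFT h ω‖ ^ 2 =
      ∫ p : (ℝ × ℝ) × (ℝ × ℝ), inner ℝ (h p.1) (h p.2) * gk t p.1 p.2 := by
  have c1 := expI_cont
  have c2 := expJ_cont
  have e1 : ∀ ω : ℝ × ℝ, Real.exp (-(π * t * (ω.1 ^ 2 + ω.2 ^ 2))) * ‖QFT h ω‖ ^ 2 =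
      ∫ p : (ℝ × ℝ) × (ℝ × ℝ), Real.exp (-(π * t * (ω.1 ^ 2 + ω.2 ^ 2))) *
      inner ℝ (expI (-(2 * π * p.1.1 * ω.1)) * h p.1 * expJ (-(2 * π * p.1.2 * ω.2)))
        (expI (-(2 * π * p.2.1 * ω.1)) * h p.2 * expJ (-(2 * π * p.2.2 * ω.2))) := by
    intro ω
    rw [integral_const_mul]
    congr 1
    have := inner_prod_integral _ (phase_integrable h hc hi ω)
    rw [this]; rfl
  simp only [e1]
  rw [integral_integral_swap]
  · congr 1; ext p
    exact gauss_phase t ht _ _ _ _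
  · have := (gauss2_integrable t ht).mul_prod (hi.norm.mul_prod hi.norm)
    refine this.mono ?_ ?_
    · simp only [Function.uncurry_def]
      apply Continuous.aestronglyMeasurable
      fun_prop
    · filter_upwards with q
      simp only [Function.uncurry_def, norm_mul]
      gcongr
      refine (norm_inner_le_norm _ _).trans ?_
      simp [expI_norm, expJ_norm]

lemma gauss2_one : ∫ z : ℝ × ℝ, Real.exp (-(π * 1 * (z.1 ^ 2 + z.2 ^ 2))) = 1 := by
  have h := gauss_phase 1 one_pos 1 1 0 0
  have e0 : expI 0 = 1 := by rw [expI_eq]; simp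
  have e1 : expJ 0 = 1 := by rw [expJ_eq]; simp
  simp only [Prod.fst_zero, Prod.snd_zero, mul_zero, zero_mul, neg_zero, e0, e1, mul_one,
    real_inner_self_eq_norm_sq, norm_one, one_pow, one_mul] at h
  simp only [mul_one] at h ⊢
  rw [h]; simp [gk]

lemma energy_inner_integrable (h : ℝ × ℝ → Quaternion ℝ) (hi : Integrable h)
    (t : ℝ) (ht : 0 < t) :
    Integrable (fun p : (ℝ × ℝ) × (ℝ × ℝ) => inner ℝ (h p.1) (h p.2) * gk t p.1 p.2) := by
  refine (inner_prod_integrable h hi).mul_bdd (c := 1 / t) (gk_cont t).aestronglyMeasurable ?_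
  filter_upwards with p
  rw [Real.norm_of_nonneg (gk_nonneg t ht _ _)]
  exact gk_le t ht _ _

lemma energy_scaled (h : ℝ × ℝ → Quaternion ℝ) (hc : Continuous h) (hi : Integrable h)
    (M : ℝ) (hM : ∀ x, ‖h x‖ ≤ M) (r : ℝ) (hr : 0 < r) :
    ∫ p : (ℝ × ℝ) × (ℝ × ℝ), inner ℝ (h p.1) (h p.2) * gk (r ^ 2) p.1 p.2 =
    ∫ p : (ℝ × ℝ) × (ℝ × ℝ), inner ℝ (h p.1) (h (p.1 + r • p.2)) *
      Real.exp (-(π * 1 * (p.2.1 ^ 2 + p.2.2 ^ 2))) := by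
  have i1 := energy_inner_integrable h hi (r ^ 2) (by positivity)
  have i2 : Integrable (fun p : (ℝ × ℝ) × (ℝ × ℝ) => inner ℝ (h p.1) (h (p.1 + r • p.2)) *
      Real.exp (-(π * 1 * (p.2.1 ^ 2 + p.2.2 ^ 2)))) := by
    refine ((hi.norm.mul_const M).mul_prod (gauss2_integrable 1 one_pos)).mono ?_ ?_
    · apply Continuous.aestronglyMeasurable
      fun_prop
    · filter_upwards with p
      simp only [norm_mul]
      gcongr
      refine (norm_inner_le_norm _ _).trans ?_
      rw [norm_norm]
      gcongr
      exact (hM _).trans (le_abs_self _)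
  rw [Measure.volume_eq_prod, integral_prod _ i1, integral_prod _ i2]
  congr 1; ext x
  simp only
  rw [← integral_add_left_eq_self _ x]
  have := Measure.integral_comp_smul_of_nonneg (μ := (volume : Measure (ℝ × ℝ)))
    (fun y => (inner ℝ (h x) (h (x + y)) : ℝ) * gk (r ^ 2) x (x + y)) r (hR := hr.le)
  have fr : Module.finrank ℝ (ℝ × ℝ) = 2 := by simp
  rw [fr] at this
  have e2 : ∫ y, (inner ℝ (h x) (h (x + y)) : ℝ) * gk (r ^ 2) x (x + y) =
      r ^ 2 * ∫ y, (inner ℝ (h x) (h (x + r • y)) : ℝ) * gk (r ^ 2) x (x + r • y) := by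
    rw [this, smul_eq_mul]
    field_simp
  rw [e2, ← integral_const_mul]
  congr 1; ext y
  unfold gk
  simp only [Prod.fst_add, Prod.snd_add, Prod.smul_fst, Prod.smul_snd, smul_eq_mul]
  rw [show -(π * ((x.1 - (x.1 + r * y.1)) ^ 2 + (x.2 - (x.2 + r * y.2)) ^ 2) / r ^ 2) =
    -(π * 1 * (y.1 ^ 2 + y.2 ^ 2)) by field_simp; ring]
  field_simp

lemma plancherel_le (h : ℝ × ℝ → Quaternion ℝ) (hc : Continuous h) (hi : Integrable h)
    (M : ℝ) (hM : ∀ x, ‖h x‖ ≤ M) (hQ : Integrable (fun ω => ‖QFT h ω‖ ^ 2)) :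
    ∫ x, ‖h x‖ ^ 2 ≤ ∫ ω, ‖QFT h ω‖ ^ 2 := by
  have lim : Filter.Tendsto (fun r : ℝ => ∫ p : (ℝ × ℝ) × (ℝ × ℝ),
      (inner ℝ (h p.1) (h (p.1 + r • p.2)) : ℝ) * Real.exp (-(π * 1 * (p.2.1 ^ 2 + p.2.2 ^ 2))))
      (nhdsWithin 0 (Set.Ioi 0)) (nhds (∫ p : (ℝ × ℝ) × (ℝ × ℝ),
      ‖h p.1‖ ^ 2 * Real.exp (-(π * 1 * (p.2.1 ^ 2 + p.2.2 ^ 2))))) := by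
    refine tendsto_integral_filter_of_dominated_convergence (fun p => (‖h p.1‖ * M) *
      Real.exp (-(π * 1 * (p.2.1 ^ 2 + p.2.2 ^ 2)))) ?_ ?_ ?_ ?_
    · filter_upwards with r
      apply Continuous.aestronglyMeasurable
      fun_prop
    · filter_upwards with r
      filter_upwards with p
      rw [norm_mul, Real.norm_of_nonneg (Real.exp_pos _).le]
      gcongr
      refine (norm_inner_le_norm _ _).trans ?_
      gcongr
      exact hM _
    · exact (hi.norm.mul_const M).mul_prod (gauss2_integrable 1 one_pos)
    · filter_upwards with p
      apply tendsto_nhdsWithin_of_tendsto_nhds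
      have : Continuous (fun r : ℝ => (inner ℝ (h p.1) (h (p.1 + r • p.2)) : ℝ) *
        Real.exp (-(π * 1 * (p.2.1 ^ 2 + p.2.2 ^ 2)))) := by fun_prop
      have h2 := this.tendsto 0
      simpa only [zero_smul, add_zero, real_inner_self_eq_norm_sq] using h2
  have e : ∫ p : (ℝ × ℝ) × (ℝ × ℝ),
      ‖h p.1‖ ^ 2 * Real.exp (-(π * 1 * (p.2.1 ^ 2 + p.2.2 ^ 2))) = ∫ x, ‖h x‖ ^ 2 := by
    have := integral_prod_mul (μ := (volume : Measure (ℝ × ℝ))) (ν := (volume : Measure (ℝ × ℝ)))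
      (fun x => ‖h x‖ ^ 2) (fun z : ℝ × ℝ => Real.exp (-(π * 1 * (z.1 ^ 2 + z.2 ^ 2))))
    rw [gauss2_one] at this
    exact this.trans (mul_one _)
  rw [e] at lim
  refine le_of_tendsto lim ?_
  filter_upwards [self_mem_nhdsWithin] with r hr
  have hr : 0 < r := hr
  rw [← energy_scaled h hc hi M hM r hr, ← energy_eq h hc hi _ (by positivity)]
  refine integral_mono_of_nonneg ?_ hQ ?_
  · filter_upwards with ω
    positivity
  · filter_upwards with ω
    have : Real.exp (-(π * r ^ 2 * (ω.1 ^ 2 + ω.2 ^ 2))) ≤ 1 := by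
      rw [Real.exp_le_one_iff]
      have : 0 ≤ π * r ^ 2 * (ω.1 ^ 2 + ω.2 ^ 2) := by positivity
      linarith
    have h2 : 0 ≤ ‖QFT h ω‖ ^ 2 := by positivity
    nlinarith

lemma gammaL (a r : ℝ) (ha : 0 < a) (hr : 0 < r) :
    ∫⁻ t in Set.Ioi (0 : ℝ), ENNReal.ofReal (t ^ (a - 1) * Real.exp (-(r * t))) =
      ENNReal.ofReal (Real.Gamma a * r ^ (-a)) := by
  rw [← ofReal_integral_eq_lintegral_ofReal]
  · rw [Real.integral_rpow_mul_exp_neg_mul_Ioi ha hr, one_div, Real.inv_rpow hr.le,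
      Real.rpow_neg hr.le, mul_comm]
  · by_contra hcon
    have h0 := integral_undef hcon
    have h1 := Real.integral_rpow_mul_exp_neg_mul_Ioi ha hr
    rw [h0] at h1
    have h2 : 0 < (1 / r) ^ a * Real.Gamma a :=
      mul_pos (Real.rpow_pos_of_pos (by positivity) _) (Real.Gamma_pos_of_pos ha)
    linarith
  · filter_upwards [ae_restrict_mem measurableSet_Ioi] with t ht
    have ht : 0 < t := ht
    positivity

lemma scaleL (u : ℝ) (hu : 0 < u) (g : ℝ → ENNReal) :
    ∫⁻ t in Set.Ioi (0 : ℝ), g t = ∫⁻ v in Set.Ioi (0 : ℝ), ENNReal.ofReal (1 / u) * g (v / u) := by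
  have him : (fun v : ℝ => v / u) '' Set.Ioi 0 = Set.Ioi 0 := by
    ext x
    constructor
    · rintro ⟨v, hv, rfl⟩
      exact div_pos hv hu
    · intro hx
      exact ⟨x * u, mul_pos hx hu, by field_simp⟩
  have := lintegral_image_eq_lintegral_abs_deriv_mul (s := Set.Ioi (0 : ℝ)) (f := fun v => v / u)
    (f' := fun _ => 1 / u) measurableSet_Ioi
    (fun x _ => ((hasDerivAt_id x).div_const u).hasDerivWithinAt)
    (fun x _ y _ hxy => by field_simp at hxy; exact hxy) g
  rw [him] at this
  rw [this]
  simp only [abs_of_pos (one_div_pos.mpr hu)]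

lemma betaL (a c : ℝ) (ha : 0 < a) (hc : a < c) :
    ∫⁻ v in Set.Ioi (0 : ℝ), ENNReal.ofReal (v ^ (a - 1) * (1 + v) ^ (-c)) =
      ENNReal.ofReal (Real.Gamma a * Real.Gamma (c - a) / Real.Gamma c) := by
  have hc0 : 0 < c := ha.trans hc
  have hG := Real.Gamma_pos_of_pos hc0
  have hGa := Real.Gamma_pos_of_pos ha
  have e : ∀ v ∈ Set.Ioi (0 : ℝ), ENNReal.ofReal (v ^ (a - 1) * (1 + v) ^ (-c)) =
      ENNReal.ofReal (1 / Real.Gamma c) * ∫⁻ w in Set.Ioi (0 : ℝ),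
        ENNReal.ofReal (v ^ (a - 1) * (w ^ (c - 1) * Real.exp (-((1 + v) * w)))) := by
    intro v hv
    have hv : 0 < v := hv
    have h1 : ∀ w : ℝ, ENNReal.ofReal (v ^ (a - 1) * (w ^ (c - 1) * Real.exp (-((1 + v) * w)))) =
       ENNReal.ofReal (v ^ (a - 1)) * ENNReal.ofReal (w ^ (c - 1) * Real.exp (-((1 + v) * w))) :=
      fun w => ENNReal.ofReal_mul (by positivity)
    simp only [h1]
    rw [lintegral_const_mul _ (by fun_prop), gammaL c (1 + v) hc0 (by positivity),
      ← ENNReal.ofReal_mul (by positivity), ← ENNReal.ofReal_mul (by positivity)]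
    congr 1
    field_simp
  rw [setLIntegral_congr_fun measurableSet_Ioi e, lintegral_const_mul' _ _ ENNReal.ofReal_ne_top,
    lintegral_lintegral_swap (by fun_prop)]
  have e2 : ∀ w ∈ Set.Ioi (0 : ℝ), ∫⁻ v in Set.Ioi (0 : ℝ),
        ENNReal.ofReal (v ^ (a - 1) * (w ^ (c - 1) * Real.exp (-((1 + v) * w)))) =
        ENNReal.ofReal (Real.Gamma a) *
          ENNReal.ofReal (w ^ ((c - a) - 1) * Real.exp (-(1 * w))) := by
    intro w hw
    have hw : 0 < w := hw
    have h1 : ∀ v : ℝ, ENNReal.ofReal (v ^ (a - 1) * (w ^ (c - 1) * Real.exp (-((1 + v) * w)))) =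
       ENNReal.ofReal (w ^ (c - 1) * Real.exp (-w)) *
         ENNReal.ofReal (v ^ (a - 1) * Real.exp (-(w * v))) := by
      intro v
      rw [← ENNReal.ofReal_mul (by positivity)]
      congr 1
      rw [show -((1 + v) * w) = -w + -(w * v) by ring, Real.exp_add]
      ring
    simp only [h1]
    rw [lintegral_const_mul _ (by fun_prop), gammaL a w ha hw,
      ← ENNReal.ofReal_mul (by positivity), ← ENNReal.ofReal_mul (by positivity)]
    congr 1
    rw [show c - a - 1 = (c - 1) + (-a) by ring, Real.rpow_add hw, one_mul]
    ring
  rw [setLIntegral_congr_fun measurableSet_Ioi e2, lintegral_const_mul _ (by fun_prop),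
    gammaL _ 1 (by linarith) one_pos, ← ENNReal.ofReal_mul (by positivity),
    ← ENNReal.ofReal_mul (by positivity)]
  congr 1
  rw [Real.one_rpow]
  ring

lemma gauss2_val (T : ℝ) (hT : 0 < T) :
    ∫ z : ℝ × ℝ, Real.exp (-(π * T * (z.1 ^ 2 + z.2 ^ 2))) = 1 / T := by
  have h := gauss_phase T hT 1 1 0 0
  have e0 : expI 0 = 1 := by rw [expI_eq]; simp
  have e1 : expJ 0 = 1 := by rw [expJ_eq]; simp
  simp only [Prod.fst_zero, Prod.snd_zero, mul_zero, zero_mul, neg_zero, e0, e1, mul_one,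
    real_inner_self_eq_norm_sq, norm_one, one_pow, one_mul] at h
  rw [h]; simp [gk]

/-- squared norm -/
def N2 (x : ℝ × ℝ) : ℝ := x.1 ^ 2 + x.2 ^ 2

lemma N2_nonneg (x) : 0 ≤ N2 x := by unfold N2; positivity

@[fun_prop] lemma N2_cont : Continuous N2 := by unfold N2; fun_prop
@[fun_prop] lemma N2_meas : Measurable N2 := N2_cont.measurable
@[fun_prop] lemma gk_meas : Measurable (fun p : ℝ × ((ℝ × ℝ) × (ℝ × ℝ)) => gk p.1 p.2.1 p.2.2) := by
  unfold gk; fun_prop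

lemma heat_gauss (t u : ℝ) (ht : 0 < t) (hu : 0 < u) (x : ℝ × ℝ) :
    ∫⁻ y : ℝ × ℝ, ENNReal.ofReal (gk t x y * Real.exp (-(π * N2 y * u))) =
     ENNReal.ofReal (1 / (1 + t * u) * Real.exp (-(π * N2 x * u / (1 + t * u)))) := by
  set T := (1 + t * u) / t with hT
  have hTp : 0 < T := by positivity
  have h1 : 0 < 1 + t * u := by positivity
  set c : ℝ × ℝ := (x.1 / (1 + t * u), x.2 / (1 + t * u)) with hcd
  have e : ∀ y, gk t x y * Real.exp (-(π * N2 y * u)) =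
     (1 / t * Real.exp (-(π * N2 x * u / (1 + t * u)))) *
      Real.exp (-(π * T * ((y - c).1 ^ 2 + (y - c).2 ^ 2))) := by
    intro y
    unfold gk N2
    rw [mul_assoc (1 / t), mul_assoc (1 / t), ← Real.exp_add, ← Real.exp_add]
    congr 2
    simp only [hT, hcd, Prod.fst_sub, Prod.snd_sub]
    field_simp
    ring
  simp only [e]
  rw [← ofReal_integral_eq_lintegral_ofReal]
  · rw [integral_const_mul, integral_sub_right_eq_self (fun z : ℝ × ℝ =>
      Real.exp (-(π * T * (z.1 ^ 2 + z.2 ^ 2)))) c, gauss2_val T hTp]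
    congr 1
    rw [hT]; field_simp
  · exact ((gauss2_integrable T hTp).comp_sub_right c).const_mul _
  · filter_upwards with y
    positivity

lemma rieszJ (a s : ℝ) (ha : 0 < a) (hs : a < s) (hs1 : s < 1) (x : ℝ × ℝ) (hx : 0 < N2 x) :
    ENNReal.ofReal (Real.Gamma s * π ^ (-s)) *
    ∫⁻ t in Set.Ioi (0 : ℝ), ENNReal.ofReal (t ^ (a - 1)) *
      ∫⁻ y : ℝ × ℝ, ENNReal.ofReal (gk t x y * N2 y ^ (-s)) =
    ENNReal.ofReal (Real.Gamma (s - a) * (π * N2 x) ^ (-(s - a)) *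
      (Real.Gamma a * Real.Gamma (1 - s) / Real.Gamma (1 - s + a))) := by
  have hs0 : 0 < s := ha.trans hs
  have hGs := Real.Gamma_pos_of_pos hs0
  have hGsa := Real.Gamma_pos_of_pos (sub_pos.2 hs)
  have hpi := Real.pi_pos
  have nz : ∀ᵐ y : ℝ × ℝ, 0 < N2 y := by
    have : ∀ᵐ y : ℝ × ℝ, y ≠ 0 := Measure.ae_ne volume 0
    filter_upwards [this] with y hy
    unfold N2
    rcases eq_or_ne y.1 0 with h | h
    · have : y.2 ≠ 0 := fun h' => hy (Prod.ext h h')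
      positivity
    · positivity
  have mgk : ∀ t : ℝ, Measurable (fun y : ℝ × ℝ => gk t x y) := by
    intro t; unfold gk; fun_prop
  -- step 1
  have s1 : ∀ t ∈ Set.Ioi (0 : ℝ), ENNReal.ofReal (Real.Gamma s * π ^ (-s)) *
      (ENNReal.ofReal (t ^ (a - 1)) * ∫⁻ y : ℝ × ℝ, ENNReal.ofReal (gk t x y * N2 y ^ (-s))) =
      ∫⁻ u in Set.Ioi (0 : ℝ), ENNReal.ofReal (t ^ (a - 1) * u ^ (s - 1) *
        (1 / (1 + t * u) * Real.exp (-(π * N2 x * u / (1 + t * u))))) := by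
    intro t ht
    have ht : 0 < t := ht
    have b1 : ENNReal.ofReal (Real.Gamma s * π ^ (-s)) *
        ∫⁻ y : ℝ × ℝ, ENNReal.ofReal (gk t x y * N2 y ^ (-s)) =
        ∫⁻ y : ℝ × ℝ, ∫⁻ u in Set.Ioi (0 : ℝ), ENNReal.ofReal (u ^ (s - 1)) *
          ENNReal.ofReal (gk t x y * Real.exp (-(π * N2 y * u))) := by
      rw [← lintegral_const_mul' _ _ ENNReal.ofReal_ne_top]
      apply lintegral_congr_ae
      filter_upwards [nz] with y hy
      have hg := gk_nonneg t ht x y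
      have : ∀ u ∈ Set.Ioi (0 : ℝ), ENNReal.ofReal (u ^ (s - 1)) *
          ENNReal.ofReal (gk t x y * Real.exp (-(π * N2 y * u))) =
          ENNReal.ofReal (gk t x y) * ENNReal.ofReal (u ^ (s - 1) * Real.exp (-((π * N2 y) * u))) := by
        intro u hu
        have hu : 0 < u := hu
        rw [← ENNReal.ofReal_mul (by positivity), ← ENNReal.ofReal_mul (by positivity)]
        congr 1; ring
      rw [setLIntegral_congr_fun measurableSet_Ioi this,
        lintegral_const_mul' _ _ ENNReal.ofReal_ne_top, gammaL s _ hs0 (by positivity),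
        ← ENNReal.ofReal_mul (by positivity), ← ENNReal.ofReal_mul (by positivity),
        Real.mul_rpow hpi.le hy.le]
      congr 1; ring
    rw [mul_left_comm, b1, lintegral_lintegral_swap,
      ← lintegral_const_mul' _ _ ENNReal.ofReal_ne_top]
    · apply setLIntegral_congr_fun measurableSet_Ioi
      intro u hu
      have hu : 0 < u := hu
      simp only
      rw [lintegral_const_mul' _ _ ENNReal.ofReal_ne_top, heat_gauss t u ht hu x,
        ← ENNReal.ofReal_mul (by positivity), ← ENNReal.ofReal_mul (by positivity),
        ← mul_assoc (t ^ (a - 1))]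
    · have := mgk t
      apply Measurable.aemeasurable
      simp only [Function.uncurry_def]
      fun_prop
  rw [← lintegral_const_mul' _ _ ENNReal.ofReal_ne_top, setLIntegral_congr_fun measurableSet_Ioi s1,
    lintegral_lintegral_swap (by fun_prop)]
  -- step 2: scaling
  have s2 : ∀ u ∈ Set.Ioi (0 : ℝ), ∫⁻ t in Set.Ioi (0 : ℝ),
      ENNReal.ofReal (t ^ (a - 1) * u ^ (s - 1) *
        (1 / (1 + t * u) * Real.exp (-(π * N2 x * u / (1 + t * u))))) =
      ∫⁻ v in Set.Ioi (0 : ℝ), ENNReal.ofReal (v ^ (a - 1) * (1 / (1 + v)) *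
        (u ^ ((s - a) - 1) * Real.exp (-((π * N2 x / (1 + v)) * u)))) := by
    intro u hu
    have hu : 0 < u := hu
    rw [scaleL u hu]
    apply setLIntegral_congr_fun measurableSet_Ioi
    intro v hv
    have hv : 0 < v := hv
    simp only
    rw [← ENNReal.ofReal_mul (by positivity), div_mul_cancel₀ _ hu.ne', Real.div_rpow hv.le hu.le,
      show s - a - 1 = (s - 1) + (-(a - 1)) + (-1) by ring, Real.rpow_add hu, Real.rpow_add hu,
      Real.rpow_neg hu.le, Real.rpow_neg_one]
    congr 1
    have : (u ^ (a - 1)) ≠ 0 := (Real.rpow_pos_of_pos hu _).ne'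
    rw [show π * N2 x * u / (1 + v) = π * N2 x / (1 + v) * u by ring]
    field_simp
  rw [setLIntegral_congr_fun measurableSet_Ioi s2, lintegral_lintegral_swap (by fun_prop)]
  have s3 : ∀ v ∈ Set.Ioi (0 : ℝ), ∫⁻ u in Set.Ioi (0 : ℝ),
      ENNReal.ofReal (v ^ (a - 1) * (1 / (1 + v)) *
        (u ^ ((s - a) - 1) * Real.exp (-((π * N2 x / (1 + v)) * u)))) =
      ENNReal.ofReal (Real.Gamma (s - a) * (π * N2 x) ^ (-(s - a))) *
        ENNReal.ofReal (v ^ (a - 1) * (1 + v) ^ (-(1 - s + a))) := by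
    intro v hv
    have hv : 0 < v := hv
    have h1 : ∀ u : ℝ, ENNReal.ofReal (v ^ (a - 1) * (1 / (1 + v)) *
        (u ^ ((s - a) - 1) * Real.exp (-((π * N2 x / (1 + v)) * u)))) =
        ENNReal.ofReal (v ^ (a - 1) * (1 / (1 + v))) *
         ENNReal.ofReal (u ^ ((s - a) - 1) * Real.exp (-((π * N2 x / (1 + v)) * u))) :=
      fun u => ENNReal.ofReal_mul (by positivity)
    simp only [h1]
    rw [lintegral_const_mul' _ _ ENNReal.ofReal_ne_top, gammaL _ _ (sub_pos.2 hs) (by positivity),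
      ← ENNReal.ofReal_mul (by positivity), ← ENNReal.ofReal_mul (by positivity)]
    congr 1
    rw [Real.div_rpow (by positivity) (by positivity),
      show -(1 - s + a) = (s - a) + (-1) by ring, Real.rpow_add (by positivity), Real.rpow_neg_one,
      Real.rpow_neg (x := 1 + v) (by positivity)]
    field_simp
  rw [setLIntegral_congr_fun measurableSet_Ioi s3, lintegral_const_mul' _ _ ENNReal.ofReal_ne_top,
    betaL _ _ ha (by linarith), ← ENNReal.ofReal_mul (by positivity)]
  congr 4
  ring_nf

lemma QFT_cont (h : ℝ × ℝ → Quaternion ℝ) (hc : Continuous h) (hi : Integrable h) :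
    Continuous (QFT h) := by
  have c1 := expI_cont
  have c2 := expJ_cont
  refine continuous_of_dominated (bound := fun x => ‖h x‖) ?_ ?_ hi.norm ?_
  · intro ω
    exact (phase_integrable h hc hi ω).1
  · intro ω
    filter_upwards with x
    simp [expI_norm, expJ_norm]
  · filter_upwards with x
    fun_prop

lemma QFT_bound (h : ℝ × ℝ → Quaternion ℝ) (ω : ℝ × ℝ) : ‖QFT h ω‖ ≤ ∫ x, ‖h x‖ := by
  refine (norm_integral_le_integral_norm _).trans (le_of_eq ?_)
  congr 1; ext x
  simp [expI_norm, expJ_norm]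

lemma N2_ae : ∀ᵐ y : ℝ × ℝ, 0 < N2 y := by
  have : ∀ᵐ y : ℝ × ℝ, y ≠ 0 := Measure.ae_ne volume 0
  filter_upwards [this] with y hy
  unfold N2
  rcases eq_or_ne y.1 0 with h | h
  · have : y.2 ≠ 0 := fun h' => hy (Prod.ext h h')
    positivity
  · positivity

lemma energy_le (h : ℝ × ℝ → Quaternion ℝ) (hc : Continuous h) (hi : Integrable h)
    (t s : ℝ) (ht : 0 < t) :
    ∫⁻ ω : ℝ × ℝ, ENNReal.ofReal (Real.exp (-(π * N2 ω * t)) * ‖QFT h ω‖ ^ 2) ≤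
    ∫⁻ x : ℝ × ℝ, ENNReal.ofReal (‖h x‖ ^ 2 * N2 x ^ s) *
      ∫⁻ y : ℝ × ℝ, ENNReal.ofReal (gk t x y * N2 y ^ (-s)) := by
  have hQc := QFT_cont h hc hi
  have e1 : ∀ ω : ℝ × ℝ, Real.exp (-(π * N2 ω * t)) * ‖QFT h ω‖ ^ 2 =
      Real.exp (-(π * t * (ω.1 ^ 2 + ω.2 ^ 2))) * ‖QFT h ω‖ ^ 2 := by
    intro ω; unfold N2; congr 3; ring
  simp only [e1]
  rw [← ofReal_integral_eq_lintegral_ofReal]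
  rotate_left
  · refine (gauss2_integrable t ht).mul_bdd (c := (∫ x, ‖h x‖) ^ 2) (by fun_prop) ?_
    filter_upwards with ω
    rw [norm_pow, norm_norm]
    gcongr
    exact QFT_bound h ω
  · filter_upwards with ω
    positivity
  rw [energy_eq h hc hi t ht]
  have i1 := energy_inner_integrable h hi t ht
  have mgk : Measurable (fun p : (ℝ × ℝ) × (ℝ × ℝ) => gk t p.1 p.2) := (gk_cont t).measurable
  set F : (ℝ × ℝ) × (ℝ × ℝ) → ENNReal := fun p =>
    ENNReal.ofReal (1 / 2 * (‖h p.1‖ ^ 2 * N2 p.1 ^ s * (gk t p.1 p.2 * N2 p.2 ^ (-s)))) with hF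
  have hFm : Measurable F := by
    have : Measurable (fun x => ‖h x‖) := hc.norm.measurable
    have m1 : Measurable (fun p : (ℝ × ℝ) × (ℝ × ℝ) => ‖h p.1‖) := this.comp measurable_fst
    have m2 : Measurable (fun p : (ℝ × ℝ) × (ℝ × ℝ) => N2 p.1 ^ s) := by fun_prop
    have m3 : Measurable (fun p : (ℝ × ℝ) × (ℝ × ℝ) => N2 p.2 ^ (-s)) := by fun_prop
    exact ENNReal.measurable_ofReal.comp ((((m1.pow_const 2).mul m2).mul (mgk.mul m3)).const_mul _)
  have h1 : ENNReal.ofReal (∫ p : (ℝ × ℝ) × (ℝ × ℝ), inner ℝ (h p.1) (h p.2) * gk t p.1 p.2) ≤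
      ∫⁻ p : (ℝ × ℝ) × (ℝ × ℝ), (F p + F p.swap) := by
    refine (ENNReal.ofReal_le_ofReal (le_abs_self _)).trans ?_
    rw [← Real.norm_eq_abs, ofReal_norm]
    refine (enorm_integral_le_lintegral_enorm _).trans ?_
    apply lintegral_mono_ae
    have n1 : ∀ᵐ p : (ℝ × ℝ) × (ℝ × ℝ), 0 < N2 p.1 :=
      Measure.quasiMeasurePreserving_fst.ae N2_ae
    have n2 : ∀ᵐ p : (ℝ × ℝ) × (ℝ × ℝ), 0 < N2 p.2 :=
      Measure.quasiMeasurePreserving_snd.ae N2_ae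
    filter_upwards [n1, n2] with p h1 h2
    have hg := gk_nonneg t ht p.1 p.2
    rw [← ofReal_norm]
    simp only [hF, Prod.fst_swap, Prod.snd_swap]
    rw [gk_symm t p.2 p.1, ← ENNReal.ofReal_add (by positivity) (by positivity)]
    apply ENNReal.ofReal_le_ofReal
    rw [norm_mul, Real.norm_of_nonneg hg]
    have i : ‖(inner ℝ (h p.1) (h p.2) : ℝ)‖ ≤ ‖h p.1‖ * ‖h p.2‖ := norm_inner_le_norm _ _
    have key : ‖h p.1‖ * ‖h p.2‖ ≤ 1 / 2 * (‖h p.1‖ ^ 2 * N2 p.1 ^ s * N2 p.2 ^ (-s) +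
       ‖h p.2‖ ^ 2 * N2 p.2 ^ s * N2 p.1 ^ (-s)) := by
      have hA := Real.rpow_pos_of_pos h1 s
      have hB := Real.rpow_pos_of_pos h2 s
      rw [Real.rpow_neg h1.le, Real.rpow_neg h2.le]
      generalize N2 p.1 ^ s = A at *
      generalize N2 p.2 ^ s = B at *
      have : 0 ≤ (‖h p.1‖ * A - ‖h p.2‖ * B) ^ 2 / (A * B) := by positivity
      have e : (‖h p.1‖ * A - ‖h p.2‖ * B) ^ 2 / (A * B) = ‖h p.1‖ ^ 2 * A * B⁻¹ +
        ‖h p.2‖ ^ 2 * B * A⁻¹ - 2 * (‖h p.1‖ * ‖h p.2‖) := by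
        field_simp; ring
      linarith
    calc _ ≤ (1 / 2 * (‖h p.1‖ ^ 2 * N2 p.1 ^ s * N2 p.2 ^ (-s) +
       ‖h p.2‖ ^ 2 * N2 p.2 ^ s * N2 p.1 ^ (-s))) * gk t p.1 p.2 := by
          gcongr; exact i.trans key
      _ = _ := by ring
  refine h1.trans ?_
  rw [lintegral_add_left hFm]
  have sw : ∫⁻ p : (ℝ × ℝ) × (ℝ × ℝ), F p.swap = ∫⁻ p, F p :=
    lintegral_prod_swap F
  rw [sw, ← two_mul, Measure.volume_eq_prod, lintegral_prod _ hFm.aemeasurable,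
    ← lintegral_const_mul' _ _ (by simp)]
  apply lintegral_mono
  intro x
  simp only
  rw [← lintegral_const_mul' _ _ (by simp), ← lintegral_const_mul' _ _ ENNReal.ofReal_ne_top]
  apply lintegral_mono
  intro y
  simp only [hF]
  have := gk_nonneg t ht x y
  have := N2_nonneg x
  rw [show (2 : ENNReal) = ENNReal.ofReal 2 by simp, ← ENNReal.ofReal_mul (by positivity),
    ← ENNReal.ofReal_mul (by positivity)]
  apply le_of_eq
  congr 1; ring

/-- Pitt constant -/
def pittC (a : ℝ) : ℝ := π ^ (2 * a) * (Real.Gamma (1 / 2 - a / 2) / Real.Gamma (1 / 2 + a / 2)) ^ 2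

lemma pitt (h : ℝ × ℝ → Quaternion ℝ) (hc : Continuous h) (hi : Integrable h)
    (a : ℝ) (ha : 0 < a) (ha1 : a < 1) :
    ∫⁻ ω : ℝ × ℝ, ENNReal.ofReal (N2 ω ^ (-a) * ‖QFT h ω‖ ^ 2) ≤
    ENNReal.ofReal (pittC a) * ∫⁻ x : ℝ × ℝ, ENNReal.ofReal (N2 x ^ a * ‖h x‖ ^ 2) := by
  have hpi := Real.pi_pos
  have hQm : Measurable (fun ω => ‖QFT h ω‖) := (QFT_cont h hc hi).norm.measurable
  have hm : Measurable (fun x => ‖h x‖) := hc.norm.measurable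
  set s : ℝ := 1 / 2 + a / 2 with hs
  have hGa := Real.Gamma_pos_of_pos ha
  have hGs : 0 < Real.Gamma s := Real.Gamma_pos_of_pos (by positivity)
  have hGsa : 0 < Real.Gamma (1 / 2 - a / 2) := Real.Gamma_pos_of_pos (by linarith)
  have s1 : ENNReal.ofReal (Real.Gamma a * π ^ (-a)) *
      ∫⁻ ω : ℝ × ℝ, ENNReal.ofReal (N2 ω ^ (-a) * ‖QFT h ω‖ ^ 2) =
      ∫⁻ t in Set.Ioi (0 : ℝ), ENNReal.ofReal (t ^ (a - 1)) *
      ∫⁻ ω : ℝ × ℝ, ENNReal.ofReal (Real.exp (-(π * N2 ω * t)) * ‖QFT h ω‖ ^ 2) := by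
    have b : ∀ t : ℝ, ENNReal.ofReal (t ^ (a - 1)) *
      ∫⁻ ω : ℝ × ℝ, ENNReal.ofReal (Real.exp (-(π * N2 ω * t)) * ‖QFT h ω‖ ^ 2) =
       ∫⁻ ω : ℝ × ℝ, ENNReal.ofReal (t ^ (a - 1)) *
         ENNReal.ofReal (Real.exp (-(π * N2 ω * t)) * ‖QFT h ω‖ ^ 2) := fun t =>
      (lintegral_const_mul' _ _ ENNReal.ofReal_ne_top).symm
    simp only [b]
    have mm : Measurable (fun p : ℝ × (ℝ × ℝ) => ENNReal.ofReal (p.1 ^ (a - 1)) *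
         ENNReal.ofReal (Real.exp (-(π * N2 p.2 * p.1)) * ‖QFT h p.2‖ ^ 2)) := by
      have m1 : Measurable (fun p : ℝ × (ℝ × ℝ) => ‖QFT h p.2‖) := hQm.comp measurable_snd
      have m2 : Measurable (fun p : ℝ × (ℝ × ℝ) => Real.exp (-(π * N2 p.2 * p.1))) := by fun_prop
      have m3 : Measurable (fun p : ℝ × (ℝ × ℝ) => ENNReal.ofReal (p.1 ^ (a - 1))) := by fun_prop
      exact m3.mul (ENNReal.measurable_ofReal.comp (m2.mul (m1.pow_const 2)))
    rw [lintegral_lintegral_swap mm.aemeasurable, ← lintegral_const_mul' _ _ ENNReal.ofReal_ne_top]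
    apply lintegral_congr_ae
    filter_upwards [N2_ae] with ω hω
    have : ∀ t ∈ Set.Ioi (0 : ℝ), ENNReal.ofReal (t ^ (a - 1)) *
         ENNReal.ofReal (Real.exp (-(π * N2 ω * t)) * ‖QFT h ω‖ ^ 2) =
        ENNReal.ofReal (‖QFT h ω‖ ^ 2) *
          ENNReal.ofReal (t ^ (a - 1) * Real.exp (-(π * N2 ω * t))) := by
      intro t ht
      have ht : 0 < t := ht
      rw [← ENNReal.ofReal_mul (by positivity), ← ENNReal.ofReal_mul (by positivity)]
      congr 1; ring
    rw [setLIntegral_congr_fun measurableSet_Ioi this,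
        lintegral_const_mul' _ _ ENNReal.ofReal_ne_top, gammaL a _ ha (by positivity),
        ← ENNReal.ofReal_mul (by positivity), ← ENNReal.ofReal_mul (by positivity),
        Real.mul_rpow hpi.le hω.le]
    congr 1; ring
  have s2 : ENNReal.ofReal (Real.Gamma a * π ^ (-a)) *
      ∫⁻ ω : ℝ × ℝ, ENNReal.ofReal (N2 ω ^ (-a) * ‖QFT h ω‖ ^ 2) ≤
      ∫⁻ x : ℝ × ℝ, ENNReal.ofReal (‖h x‖ ^ 2 * N2 x ^ s) *
        ∫⁻ t in Set.Ioi (0 : ℝ), ENNReal.ofReal (t ^ (a - 1)) *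
        ∫⁻ y : ℝ × ℝ, ENNReal.ofReal (gk t x y * N2 y ^ (-s)) := by
    rw [s1]
    have m1 : Measurable (fun q : ℝ × (ℝ × ℝ) =>
        ∫⁻ y : ℝ × ℝ, ENNReal.ofReal (gk q.1 q.2 y * N2 y ^ (-s))) := by
      apply Measurable.lintegral_prod_right'
        (f := fun r : (ℝ × (ℝ × ℝ)) × (ℝ × ℝ) => ENNReal.ofReal (gk r.1.1 r.1.2 r.2 * N2 r.2 ^ (-s)))
      unfold gk; fun_prop
    calc _ ≤ ∫⁻ t in Set.Ioi (0 : ℝ), ∫⁻ x : ℝ × ℝ, ENNReal.ofReal (t ^ (a - 1)) *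
            (ENNReal.ofReal (‖h x‖ ^ 2 * N2 x ^ s) *
              ∫⁻ y : ℝ × ℝ, ENNReal.ofReal (gk t x y * N2 y ^ (-s))) := by
          apply setLIntegral_mono' measurableSet_Ioi
          intro t ht
          rw [lintegral_const_mul' _ _ ENNReal.ofReal_ne_top]
          exact mul_le_mul' le_rfl (energy_le h hc hi t s ht)
      _ = _ := by
          rw [lintegral_lintegral_swap]
          · apply lintegral_congr
            intro x
            rw [← lintegral_const_mul' _ _ ENNReal.ofReal_ne_top]
            apply lintegral_congr
            intro t
            rw [mul_left_comm]
          · apply Measurable.aemeasurable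
            have m2 : Measurable (fun p : ℝ × (ℝ × ℝ) => ‖h p.2‖) := hm.comp measurable_snd
            have m3 : Measurable (fun p : ℝ × (ℝ × ℝ) => N2 p.2 ^ s) := by fun_prop
            have m4 : Measurable (fun p : ℝ × (ℝ × ℝ) => ENNReal.ofReal (p.1 ^ (a - 1))) := by
              fun_prop
            exact m4.mul ((ENNReal.measurable_ofReal.comp ((m2.pow_const 2).mul m3)).mul m1)
  set K : ℝ := Real.Gamma (s - a) * π ^ (-(s - a)) *
      (Real.Gamma a * Real.Gamma (1 - s) / Real.Gamma (1 - s + a)) with hK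
  have s3 : ENNReal.ofReal (Real.Gamma s * π ^ (-s)) *
      ∫⁻ x : ℝ × ℝ, ENNReal.ofReal (‖h x‖ ^ 2 * N2 x ^ s) *
        ∫⁻ t in Set.Ioi (0 : ℝ), ENNReal.ofReal (t ^ (a - 1)) *
        ∫⁻ y : ℝ × ℝ, ENNReal.ofReal (gk t x y * N2 y ^ (-s)) =
      ENNReal.ofReal K * ∫⁻ x : ℝ × ℝ, ENNReal.ofReal (N2 x ^ a * ‖h x‖ ^ 2) := by
    rw [← lintegral_const_mul' _ _ ENNReal.ofReal_ne_top,
      ← lintegral_const_mul' _ _ ENNReal.ofReal_ne_top]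
    apply lintegral_congr_ae
    filter_upwards [N2_ae] with x hx
    rw [mul_left_comm, rieszJ a s ha (by linarith) (by linarith) x hx]
    have p1 : 0 < Real.Gamma (s - a) := Real.Gamma_pos_of_pos (by linarith)
    have p2 : 0 < Real.Gamma (1 - s) := Real.Gamma_pos_of_pos (by linarith)
    have p3 : 0 < Real.Gamma (1 - s + a) := Real.Gamma_pos_of_pos (by linarith)
    rw [← ENNReal.ofReal_mul (by positivity), ← ENNReal.ofReal_mul (by positivity),
      Real.mul_rpow hpi.le hx.le, hK]
    congr 1
    have : N2 x ^ a = N2 x ^ s * N2 x ^ (-(s - a)) := by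
      rw [← Real.rpow_add hx]; congr 1; ring
    rw [this]; ring
  set g : ℝ := Real.Gamma s * π ^ (-s) * (Real.Gamma a * π ^ (-a)) with hg
  have hgp : 0 < g := by positivity
  have hKg : K = g * pittC a := by
    rw [hK, hg, pittC]
    rw [show s - a = 1 / 2 - a / 2 by rw [hs]; ring, show 1 - s = 1 / 2 - a / 2 by rw [hs]; ring,
      show 1 / 2 - a / 2 + a = s by rw [hs]; ring, show (1 : ℝ) / 2 + a / 2 = s from rfl,
      show -(1 / 2 - a / 2) = -s + -a + 2 * a by rw [hs]; ring, Real.rpow_add hpi, Real.rpow_add hpi]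
    field_simp
  have s4 : ENNReal.ofReal g * ∫⁻ ω : ℝ × ℝ, ENNReal.ofReal (N2 ω ^ (-a) * ‖QFT h ω‖ ^ 2) ≤
      ENNReal.ofReal g * (ENNReal.ofReal (pittC a) *
        ∫⁻ x : ℝ × ℝ, ENNReal.ofReal (N2 x ^ a * ‖h x‖ ^ 2)) := by
    rw [← mul_assoc (ENNReal.ofReal g), ← ENNReal.ofReal_mul hgp.le, ← hKg, ← s3, hg,
      ENNReal.ofReal_mul (by positivity), mul_assoc]
    gcongr
  exact (ENNReal.mul_le_mul_iff_right (by simpa using hgp) ENNReal.ofReal_ne_top).1 s4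

lemma fr2 : (Module.finrank ℝ (ℝ × ℝ) : ℝ) = 2 := by simp

lemma W_int (r : ℝ) (hr : 2 < r) : Integrable (fun x : ℝ × ℝ => (1 + ‖x‖) ^ (-r)) :=
  integrable_one_add_norm (by rw [fr2]; exact hr)

lemma log_euclNorm (x : ℝ × ℝ) : Real.log (euclNorm x) = 1 / 2 * Real.log (N2 x) := by
  unfold euclNorm N2
  rw [Real.log_sqrt (by positivity)]; ring

lemma N2_le (x : ℝ × ℝ) : N2 x ≤ 2 * ‖x‖ ^ 2 := by
  unfold N2
  have h1 := norm_fst_le x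
  have h2 := norm_snd_le x
  rw [Real.norm_eq_abs] at h1 h2
  have := sq_le_sq' (by linarith [abs_nonneg x.1, neg_abs_le x.1]) ((le_abs_self x.1).trans h1)
  have := sq_le_sq' (by linarith [abs_nonneg x.2, neg_abs_le x.2]) ((le_abs_self x.2).trans h2)
  linarith

lemma N2_le' (x : ℝ × ℝ) : N2 x ≤ 2 * (1 + ‖x‖) ^ 2 := by
  have := N2_le x
  nlinarith [norm_nonneg x]

lemma log_bound_aux : Integrable (fun x : ℝ × ℝ =>
    (Set.indicator (Set.Icc (-1 : ℝ) 1) (fun s => 2 * |Real.log s|) x.1) * (1 + ‖x.2‖) ^ (-2 : ℝ) +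
      2 * (1 + ‖x‖) ^ (-3 : ℝ)) := by
  have h1 : Integrable (Set.indicator (Set.Icc (-1 : ℝ) 1) (fun s => 2 * |Real.log s|)) := by
    rw [integrable_indicator_iff measurableSet_Icc]
    have : IntervalIntegrable Real.log volume (-1) 1 := intervalIntegral.intervalIntegrable_log'
    rw [intervalIntegrable_iff_integrableOn_Icc_of_le (by norm_num)] at this
    exact this.abs.const_mul 2
  have h2 : Integrable (fun x : ℝ => (1 + ‖x‖) ^ (-2 : ℝ)) :=
    integrable_one_add_norm (by simp)
  exact (h1.mul_prod h2).add ((W_int 3 (by norm_num)).const_mul 2)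

lemma log_weight : Integrable (fun x : ℝ × ℝ => Real.log (N2 x) * (1 + ‖x‖) ^ (-4 : ℝ)) := by
  refine log_bound_aux.mono' ?_ ?_
  · apply Measurable.aestronglyMeasurable
    have := Real.measurable_log
    fun_prop
  · have nz : ∀ᵐ x : ℝ × ℝ, x.1 ≠ 0 :=
      Measure.quasiMeasurePreserving_fst.ae (Measure.ae_ne volume (0 : ℝ))
    filter_upwards [nz] with x hx
    have hn := norm_nonneg x
    have hN : 0 < N2 x := by unfold N2; positivity
    have hW : 0 < (1 + ‖x‖) ^ (-4 : ℝ) := by positivity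
    have i0 : 0 ≤ Set.indicator (Set.Icc (-1 : ℝ) 1) (fun s => 2 * |Real.log s|) x.1 :=
      Set.indicator_nonneg (fun s _ => by positivity) _
    rw [norm_mul, Real.norm_of_nonneg hW.le, Real.norm_eq_abs]
    rcases le_or_gt (N2 x) 1 with h | h
    · have hx1 : x.1 ^ 2 ≤ N2 x := by unfold N2; nlinarith [sq_nonneg x.2]
      have hm : x.1 ∈ Set.Icc (-1 : ℝ) 1 := by
        have := abs_le_one_iff_mul_self_le_one.2 (by nlinarith : x.1 * x.1 ≤ 1)
        exact abs_le.1 this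
      rw [Set.indicator_of_mem hm]
      have l1 : |Real.log (N2 x)| ≤ 2 * |Real.log x.1| := by
        rw [abs_of_nonpos (Real.log_nonpos hN.le h)]
        have := Real.log_le_log (by positivity) hx1
        rw [Real.log_pow] at this
        push_cast at this
        have := neg_abs_le (Real.log x.1)
        linarith
      have l2 : (1 + ‖x‖) ^ (-4 : ℝ) ≤ (1 + ‖x.2‖) ^ (-2 : ℝ) := by
        calc (1 + ‖x‖) ^ (-4 : ℝ) ≤ (1 + ‖x‖) ^ (-2 : ℝ) :=
              Real.rpow_le_rpow_of_exponent_le (by linarith) (by norm_num)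
          _ ≤ _ := Real.rpow_le_rpow_of_nonpos (by positivity)
              (by linarith [norm_snd_le x]) (by norm_num)
      have : 0 ≤ 2 * (1 + ‖x‖) ^ (-3 : ℝ) := by positivity
      have := mul_le_mul l1 l2 hW.le (by positivity)
      linarith
    · have l1 : |Real.log (N2 x)| ≤ 2 * (1 + ‖x‖) := by
        rw [abs_of_pos (Real.log_pos h)]
        have h3 := Real.log_le_log hN (N2_le' x)
        have h4 : Real.log (2 * (1 + ‖x‖) ^ 2) = Real.log 2 + 2 * Real.log (1 + ‖x‖) := by
          rw [Real.log_mul (by norm_num) (by positivity), Real.log_pow]; norm_num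
        have h5 := Real.log_le_sub_one_of_pos (show 0 < 1 + ‖x‖ by positivity)
        have h6 := Real.log_le_sub_one_of_pos (show (0 : ℝ) < 2 by norm_num)
        linarith
      have e : (1 + ‖x‖) ^ (-3 : ℝ) = (1 + ‖x‖) * (1 + ‖x‖) ^ (-4 : ℝ) := by
        rw [show (-3 : ℝ) = 1 + (-4) by norm_num, Real.rpow_add (by positivity), Real.rpow_one]
      rw [e]
      have : 0 ≤ Set.indicator (Set.Icc (-1 : ℝ) 1) (fun s => 2 * |Real.log s|) x.1 *
        (1 + ‖x.2‖) ^ (-2 : ℝ) := by positivity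
      nlinarith

lemma log_mul_integrable (F : ℝ × ℝ → ℝ) (hF : AEStronglyMeasurable F) (c : ℝ)
    (hb : ∀ x, |F x| ≤ c * (1 + ‖x‖) ^ (-4 : ℝ)) : Integrable (fun x => Real.log (N2 x) * F x) := by
  refine (log_weight.norm.const_mul c).mono' ?_ ?_
  · refine AEStronglyMeasurable.mul ?_ hF
    apply Measurable.aestronglyMeasurable
    have := Real.measurable_log
    fun_prop
  · filter_upwards with x
    have hW : 0 < (1 + ‖x‖) ^ (-4 : ℝ) := by positivity
    rw [norm_mul, norm_mul, Real.norm_of_nonneg hW.le, Real.norm_eq_abs (F x)]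
    have := mul_le_mul_of_nonneg_left (hb x) (norm_nonneg (Real.log (N2 x)))
    linarith

lemma sq_bound (A c r : ℝ) (x : ℝ × ℝ) (hA : 0 ≤ A) (h : A ≤ c * (1 + ‖x‖) ^ (-r)) :
    A ^ 2 ≤ c ^ 2 * (1 + ‖x‖) ^ (-(2 * r)) := by
  have := pow_le_pow_left₀ hA h 2
  rw [mul_pow, ← Real.rpow_natCast ((1 + ‖x‖) ^ (-r)) 2, ← Real.rpow_mul (by positivity)] at this
  rw [show -(2 * r) = -r * ((2 : ℕ) : ℝ) by push_cast; ring]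
  exact this

lemma pittC_deriv : HasDerivAt pittC
    (2 * Real.log π - 2 * (deriv Real.Gamma (1 / 2) / Real.Gamma (1 / 2))) 0 := by
  have hG : HasDerivAt Real.Gamma (deriv Real.Gamma (1 / 2)) (1 / 2) := by
    apply DifferentiableAt.hasDerivAt
    apply Real.differentiableAt_Gamma
    intro m hm
    have : (0 : ℝ) ≤ m := Nat.cast_nonneg m
    linarith
  have hG0 : Real.Gamma (1 / 2) ≠ 0 := (Real.Gamma_pos_of_pos (by norm_num)).ne'
  have l1 : HasDerivAt (fun a : ℝ => 1 / 2 - a / 2) (-(1 / 2)) 0 :=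
    ((hasDerivAt_id (0 : ℝ)).div_const 2).const_sub (1 / 2)
  have l2 : HasDerivAt (fun a : ℝ => 1 / 2 + a / 2) (1 / 2) 0 :=
    ((hasDerivAt_id (0 : ℝ)).div_const 2).const_add (1 / 2)
  have g1 : HasDerivAt (fun a : ℝ => Real.Gamma (1 / 2 - a / 2))
      (deriv Real.Gamma (1 / 2) * -(1 / 2)) 0 := by
    refine HasDerivAt.comp (0 : ℝ) (h₂ := Real.Gamma) ?_ l1
    simpa using hG
  have g2 : HasDerivAt (fun a : ℝ => Real.Gamma (1 / 2 + a / 2))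
      (deriv Real.Gamma (1 / 2) * (1 / 2)) 0 := by
    refine HasDerivAt.comp (0 : ℝ) (h₂ := Real.Gamma) ?_ l2
    simpa using hG
  have g3 := (g1.fun_div g2 (by simpa using hG0)).fun_pow 2
  have p1 : HasDerivAt (fun a : ℝ => π ^ (2 * a)) (2 * Real.log π) 0 := by
    have := ((hasDerivAt_id (0 : ℝ)).const_mul 2).const_rpow (a := π) Real.pi_pos
    simpa [mul_comm] using this
  have := p1.fun_mul g3
  unfold pittC
  convert! this using 1
  simp only [zero_div, sub_zero, add_zero, mul_zero, Real.rpow_zero]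
  field_simp
  ring

lemma rpow_le_aux (N a : ℝ) (hN : 0 ≤ N) (ha : 0 < a) (ha1 : a < 1) : N ^ a ≤ 1 + a * (N - 1) := by
  have := _root_.rpow_one_add_le_one_add_mul_self (s := N - 1) (by linarith) ha.le ha1.le
  simpa using this

lemma rpow_ge_aux (N a : ℝ) (hN : 0 < N) : 1 + a * Real.log N ≤ N ^ a := by
  rw [Real.rpow_def_of_pos hN]
  have := Real.add_one_le_exp (Real.log N * a)
  linarith

lemma slope_lim (N : ℝ) (hN : 0 < N) :
    Filter.Tendsto (fun a : ℝ => (N ^ a - 1) / a) (nhdsWithin 0 (Set.Ioi 0)) (nhds (Real.log N)) := by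
  have h : HasDerivAt (fun a : ℝ => N ^ a) (Real.log N) 0 := by
    have := (hasDerivAt_id (0 : ℝ)).const_rpow hN
    simpa using this
  have := h.hasDerivWithinAt (s := Set.Ioi 0)
  rw [hasDerivWithinAt_iff_tendsto_slope' (by simp)] at this
  refine this.congr fun a => ?_
  simp [slope, div_eq_inv_mul]

lemma pow_int (g : ℝ × ℝ → ℝ) (hg0 : ∀ x, 0 ≤ g x) (hg : Integrable g)
    (hN : Integrable (fun x => N2 x * g x)) (a : ℝ) (ha : 0 < a) (ha1 : a < 1) :
    Integrable (fun x => N2 x ^ a * g x) := by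
  refine (hg.add hN).mono' ?_ ?_
  · refine AEStronglyMeasurable.mul ?_ hg.1
    apply Measurable.aestronglyMeasurable
    have := N2_meas
    fun_prop
  · filter_upwards with x
    have h0 := Real.rpow_nonneg (N2_nonneg x) a
    rw [Real.norm_of_nonneg (mul_nonneg h0 (hg0 x))]
    have h1 := rpow_le_aux (N2 x) a (N2_nonneg x) ha ha1
    have h2 : N2 x ^ a ≤ 1 + N2 x := by nlinarith [N2_nonneg x]
    have := mul_le_mul_of_nonneg_right h2 (hg0 x)
    simp only [Pi.add_apply]
    linarith

lemma pow_lim (g : ℝ × ℝ → ℝ) (hg0 : ∀ x, 0 ≤ g x) (hg : Integrable g)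
    (hN : Integrable (fun x => N2 x * g x)) (hL : Integrable (fun x => Real.log (N2 x) * g x)) :
    Filter.Tendsto (fun a : ℝ => ((∫ x, N2 x ^ a * g x) - ∫ x, g x) / a) (nhdsWithin 0 (Set.Ioi 0))
      (nhds (∫ x, Real.log (N2 x) * g x)) := by
  have key : Filter.Tendsto (fun a : ℝ => ∫ x, (N2 x ^ a - 1) / a * g x) (nhdsWithin 0 (Set.Ioi 0))
      (nhds (∫ x, Real.log (N2 x) * g x)) := by
    refine tendsto_integral_filter_of_dominated_convergence
      (fun x => |Real.log (N2 x) * g x| + (g x + N2 x * g x)) ?_ ?_ ?_ ?_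
    · filter_upwards with a
      refine AEStronglyMeasurable.mul ?_ hg.1
      apply Measurable.aestronglyMeasurable
      have := N2_meas
      fun_prop
    · have hm : Set.Ioo (0 : ℝ) 1 ∈ nhdsWithin (0 : ℝ) (Set.Ioi 0) := Ioo_mem_nhdsGT one_pos
      filter_upwards [hm] with a ha
      filter_upwards [N2_ae] with x hx
      have h1 := rpow_le_aux (N2 x) a hx.le ha.1 ha.2
      have h2 := rpow_ge_aux (N2 x) a hx
      have h3 : (N2 x ^ a - 1) / a ≤ N2 x - 1 := by
        rw [div_le_iff₀ ha.1]; linarith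
      have h4 : Real.log (N2 x) ≤ (N2 x ^ a - 1) / a := by
        rw [le_div_iff₀ ha.1]; linarith
      rw [norm_mul, Real.norm_of_nonneg (hg0 x), abs_mul, abs_of_nonneg (hg0 x),
        show ∀ u : ℝ, u * g x + (g x + N2 x * g x) = (u + (1 + N2 x)) * g x by intro u; ring]
      refine mul_le_mul_of_nonneg_right ?_ (hg0 x)
      rw [Real.norm_eq_abs, abs_le]
      constructor
      · have := neg_abs_le (Real.log (N2 x)); linarith
      · have := abs_nonneg (Real.log (N2 x)); linarith
    · exact hL.abs.add (hg.add hN)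
    · filter_upwards [N2_ae] with x hx
      exact (slope_lim (N2 x) hx).mul_const _
  refine key.congr' ?_
  have hm : Set.Ioo (0 : ℝ) 1 ∈ nhdsWithin (0 : ℝ) (Set.Ioi 0) := Ioo_mem_nhdsGT one_pos
  filter_upwards [hm] with a ha
  rw [← integral_sub (pow_int g hg0 hg hN a ha.1 ha.2) hg, ← integral_div]
  congr 1; ext x; ring

lemma log_qft (h : ℝ × ℝ → Quaternion ℝ) (hc : Continuous h) (c c' : ℝ)
    (hb : ∀ x, ‖h x‖ ≤ c * (1 + ‖x‖) ^ (-4 : ℝ)) (hb' : ∀ ω, ‖QFT h ω‖ ≤ c' * (1 + ‖ω‖) ^ (-2 : ℝ)) :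
    (deriv Real.Gamma (1 / 2) / Real.Gamma (1 / 2) - Real.log π) * (∫ x, ‖h x‖ ^ 2) ≤
      (∫ x, Real.log (euclNorm x) * ‖h x‖ ^ 2) + ∫ ω, Real.log (euclNorm ω) * ‖QFT h ω‖ ^ 2 := by
  have hi : Integrable h := by
    refine ((W_int 4 (by norm_num)).const_mul c).mono' hc.aestronglyMeasurable ?_
    filter_upwards with x using hb x
  have hQc := QFT_cont h hc hi
  have hh2 : ∀ x, ‖h x‖ ^ 2 ≤ c ^ 2 * (1 + ‖x‖) ^ (-8 : ℝ) := fun x => by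
    have := sq_bound _ c 4 x (norm_nonneg _) (hb x); norm_num at this ⊢; exact this
  have hQ2 : ∀ x, ‖QFT h x‖ ^ 2 ≤ c' ^ 2 * (1 + ‖x‖) ^ (-4 : ℝ) := fun x => by
    have := sq_bound _ c' 2 x (norm_nonneg _) (hb' x); norm_num at this ⊢; exact this
  have hM : ∀ x, ‖h x‖ ≤ c := fun x => by
    have h1 : (1 + ‖x‖) ^ (-4 : ℝ) ≤ 1 :=
      Real.rpow_le_one_of_one_le_of_nonpos (by linarith [norm_nonneg x]) (by norm_num)
    have hc0 : 0 ≤ c := by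
      have := (norm_nonneg _).trans (hb 0); simpa using this
    nlinarith [hb x]
  have mh : AEStronglyMeasurable (fun x => ‖h x‖ ^ 2) := (hc.norm.pow 2).aestronglyMeasurable
  have mQ : AEStronglyMeasurable (fun x => ‖QFT h x‖ ^ 2) := (hQc.norm.pow 2).aestronglyMeasurable
  have ih : Integrable (fun x => ‖h x‖ ^ 2) := by
    refine ((W_int 8 (by norm_num)).const_mul (c ^ 2)).mono' mh ?_
    filter_upwards with x
    rw [Real.norm_of_nonneg (by positivity)]; exact hh2 x
  have iQ : Integrable (fun x => ‖QFT h x‖ ^ 2) := by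
    refine ((W_int 4 (by norm_num)).const_mul (c' ^ 2)).mono' mQ ?_
    filter_upwards with x
    rw [Real.norm_of_nonneg (by positivity)]; exact hQ2 x
  have iN : Integrable (fun x => N2 x * ‖h x‖ ^ 2) := by
    refine ((W_int 6 (by norm_num)).const_mul (2 * c ^ 2)).mono'
      ((N2_cont.mul (hc.norm.pow 2)).aestronglyMeasurable) ?_
    filter_upwards with x
    rw [Real.norm_of_nonneg (mul_nonneg (N2_nonneg x) (by positivity))]
    have e : (1 + ‖x‖) ^ (-6 : ℝ) = (1 + ‖x‖) ^ 2 * (1 + ‖x‖) ^ (-8 : ℝ) := by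
      rw [← Real.rpow_natCast, ← Real.rpow_add (by positivity)]; norm_num
    calc N2 x * ‖h x‖ ^ 2 ≤ (2 * (1 + ‖x‖) ^ 2) * (c ^ 2 * (1 + ‖x‖) ^ (-8 : ℝ)) :=
          mul_le_mul (N2_le' x) (hh2 x) (by positivity) (by positivity)
      _ = _ := by rw [e]; ring
  have iLh : Integrable (fun x => Real.log (N2 x) * ‖h x‖ ^ 2) := by
    refine log_mul_integrable _ mh (c ^ 2) fun x => ?_
    rw [abs_of_nonneg (by positivity)]
    refine (hh2 x).trans (mul_le_mul_of_nonneg_left ?_ (sq_nonneg c))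
    exact Real.rpow_le_rpow_of_exponent_le (by linarith [norm_nonneg x]) (by norm_num)
  have iLQ : Integrable (fun x => Real.log (N2 x) * ‖QFT h x‖ ^ 2) := by
    refine log_mul_integrable _ mQ (c' ^ 2) fun x => ?_
    rw [abs_of_nonneg (by positivity)]
    exact hQ2 x
  have hpl := plancherel_le h hc hi c hM iQ
  have hg0 : ∀ x, 0 ≤ ‖h x‖ ^ 2 := fun x => by positivity
  set I0 := ∫ x, ‖h x‖ ^ 2 with hI0
  set LQ := ∫ x, Real.log (N2 x) * ‖QFT h x‖ ^ 2 with hLQ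
  set Lh := ∫ x, Real.log (N2 x) * ‖h x‖ ^ 2 with hLh
  set S : ℝ → ℝ := fun a => ((∫ x, N2 x ^ a * ‖h x‖ ^ 2) - I0) / a with hS
  have hSl : Filter.Tendsto S (nhdsWithin 0 (Set.Ioi 0)) (nhds Lh) :=
    pow_lim (fun x => ‖h x‖ ^ 2) hg0 ih iN iLh
  have hm : Set.Ioo (0 : ℝ) 1 ∈ nhdsWithin (0 : ℝ) (Set.Ioi 0) := Ioo_mem_nhdsGT one_pos
  have p0 : pittC 0 = 1 := by
    have hG0 : Real.Gamma (1 / 2) ≠ 0 := (Real.Gamma_pos_of_pos (by norm_num)).ne'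
    unfold pittC
    simp only [mul_zero, Real.rpow_zero, zero_div, sub_zero, add_zero, div_self hG0, one_pow, mul_one]
  have ineq : ∀ a ∈ Set.Ioo (0 : ℝ) 1,
      -LQ ≤ ((pittC a - 1) / a) * (I0 + a * S a) + S a := by
    intro a ha
    have iP := pow_int (fun x => ‖h x‖ ^ 2) hg0 ih iN a ha.1 ha.2
    have hp := pitt h hc hi a ha.1 ha.2
    have hpc : 0 ≤ pittC a := by unfold pittC; positivity
    have q0 : ∀ x, 0 ≤ N2 x ^ (-a) * ‖QFT h x‖ ^ 2 := fun x =>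
      mul_nonneg (Real.rpow_nonneg (N2_nonneg x) _) (by positivity)
    have r0 : ∀ x, 0 ≤ N2 x ^ a * ‖h x‖ ^ 2 := fun x =>
      mul_nonneg (Real.rpow_nonneg (N2_nonneg x) _) (by positivity)
    have mq : AEStronglyMeasurable (fun x => N2 x ^ (-a) * ‖QFT h x‖ ^ 2) := by
      refine AEStronglyMeasurable.mul ?_ mQ
      apply Measurable.aestronglyMeasurable
      have := N2_meas
      fun_prop
    rw [← ofReal_integral_eq_lintegral_ofReal iP (Filter.Eventually.of_forall r0),
      ← ENNReal.ofReal_mul hpc] at hp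
    have iq : Integrable (fun x => N2 x ^ (-a) * ‖QFT h x‖ ^ 2) :=
      (lintegral_ofReal_ne_top_iff_integrable mq (Filter.Eventually.of_forall q0)).1
        (ne_top_of_le_ne_top ENNReal.ofReal_ne_top hp)
    rw [← ofReal_integral_eq_lintegral_ofReal iq (Filter.Eventually.of_forall q0),
      ENNReal.ofReal_le_ofReal_iff (mul_nonneg hpc (integral_nonneg r0))] at hp
    have lo : (∫ x, ‖QFT h x‖ ^ 2) - a * LQ ≤ ∫ x, N2 x ^ (-a) * ‖QFT h x‖ ^ 2 := by
      rw [hLQ, ← integral_const_mul, ← integral_sub iQ (iLQ.const_mul a)]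
      refine integral_mono_ae (iQ.sub (iLQ.const_mul a)) iq ?_
      filter_upwards [N2_ae] with x hx
      have := mul_le_mul_of_nonneg_right (rpow_ge_aux (N2 x) (-a) hx) (sq_nonneg ‖QFT h x‖)
      linarith
    have eS : I0 + a * S a = ∫ x, N2 x ^ a * ‖h x‖ ^ 2 := by
      rw [hS]; simp only; have := ha.1.ne'; field_simp; ring
    rw [← eS] at hp
    have t : I0 - a * LQ ≤ pittC a * (I0 + a * S a) := by linarith
    have e2 : ((pittC a - 1) / a) * (I0 + a * S a) + S a = (pittC a * (I0 + a * S a) - I0) / a := by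
      have := ha.1.ne'; field_simp; ring
    rw [e2, le_div_iff₀ ha.1]; linarith
  have hd := pittC_deriv.hasDerivWithinAt (s := Set.Ioi 0)
  rw [hasDerivWithinAt_iff_tendsto_slope' (by simp)] at hd
  have hd' : Filter.Tendsto (fun a => (pittC a - 1) / a) (nhdsWithin 0 (Set.Ioi 0))
      (nhds (2 * Real.log π - 2 * (deriv Real.Gamma (1 / 2) / Real.Gamma (1 / 2)))) := by
    refine hd.congr fun a => ?_
    simp [slope, div_eq_inv_mul, p0]
  have ha0 : Filter.Tendsto (fun a : ℝ => a) (nhdsWithin 0 (Set.Ioi 0)) (nhds 0) :=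
    tendsto_nhdsWithin_of_tendsto_nhds Filter.tendsto_id
  have lim := (hd'.mul ((ha0.mul hSl).const_add I0)).add hSl
  have fin := ge_of_tendsto lim (Filter.eventually_of_mem hm ineq)
  simp only [log_euclNorm, mul_assoc]
  rw [integral_const_mul, integral_const_mul]
  linarith

lemma expI_deriv (θ : ℝ) : HasDerivAt expI (qI * expI θ) θ := by
  have h : HasDerivAt (fun t : ℝ => Real.cos t • (1 : Quaternion ℝ) + Real.sin t • qI)
      ((-Real.sin θ) • (1 : Quaternion ℝ) + Real.cos θ • qI) θ :=
    ((Real.hasDerivAt_cos θ).smul_const _).add ((Real.hasDerivAt_sin θ).smul_const _)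
  have e : expI = fun t : ℝ => Real.cos t • (1 : Quaternion ℝ) + Real.sin t • qI := by
    funext t; exact expI_eq t
  have e2 : qI * expI θ = (-Real.sin θ) • (1 : Quaternion ℝ) + Real.cos θ • qI := by
    ext <;> simp [Quaternion.re_one, Quaternion.imI_one, Quaternion.imJ_one, Quaternion.imK_one]
  rw [e2, e]; exact h

lemma expJ_deriv (θ : ℝ) : HasDerivAt expJ (expJ θ * qJ) θ := by
  have h : HasDerivAt (fun t : ℝ => Real.cos t • (1 : Quaternion ℝ) + Real.sin t • qJ)
      ((-Real.sin θ) • (1 : Quaternion ℝ) + Real.cos θ • qJ) θ :=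
    ((Real.hasDerivAt_cos θ).smul_const _).add ((Real.hasDerivAt_sin θ).smul_const _)
  have e : expJ = fun t : ℝ => Real.cos t • (1 : Quaternion ℝ) + Real.sin t • qJ := by
    funext t; exact expJ_eq t
  have e2 : expJ θ * qJ = (-Real.sin θ) • (1 : Quaternion ℝ) + Real.cos θ • qJ := by
    ext <;> simp [Quaternion.re_one, Quaternion.imI_one, Quaternion.imJ_one, Quaternion.imK_one]
  rw [e2, e]; exact h

lemma qI_norm : ‖qI‖ = 1 := by
  have h := expI_norm (π / 2)
  rw [expI_eq] at h; simpa using h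

lemma qJ_norm : ‖qJ‖ = 1 := by
  have h := expJ_norm (π / 2)
  rw [expJ_eq] at h; simpa using h

lemma int_lineDeriv_zero (F F' : ℝ × ℝ → Quaternion ℝ) (v : ℝ × ℝ) (hF : Integrable F)
    (hF' : Integrable F') (hd : ∀ x, HasLineDerivAt ℝ F (F' x) x v) : ∫ x, F' x = 0 := by
  have := integral_bilinear_hasLineDerivAt_right_eq_neg_left_of_integrable
    (μ := (volume : Measure (ℝ × ℝ))) (f := fun _ => (1 : ℝ)) (f' := fun _ => 0) (g := F) (g' := F')
    (v := v) (B := ContinuousLinearMap.lsmul ℝ ℝ) (by simp) (by simpa using hF')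
    (by simpa using hF) (fun x _ => by
      unfold HasLineDerivAt; exact hasDerivAt_const _ _) (fun x _ => hd x)
  simpa using this

lemma ibp1 (h h' : ℝ × ℝ → Quaternion ℝ) (hc : Continuous h) (hi : Integrable h)
    (hc' : Continuous h') (hi' : Integrable h') (hd : ∀ x, HasLineDerivAt ℝ h (h' x) x (1, 0))
    (ω : ℝ × ℝ) : 2 * π * |ω.1| * ‖QFT h ω‖ = ‖QFT h' ω‖ := by
  have i1 := phase_integrable h hc hi ω
  have i2 := phase_integrable h' hc' hi' ω
  have i3 : Integrable (fun x : ℝ × ℝ => (-(2 * π * ω.1)) • (qI *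
      (expI (-(2 * π * x.1 * ω.1)) * h x * expJ (-(2 * π * x.2 * ω.2))))) :=
    (i1.const_mul qI).smul (-(2 * π * ω.1))
  have z := int_lineDeriv_zero
    (fun x => expI (-(2 * π * x.1 * ω.1)) * h x * expJ (-(2 * π * x.2 * ω.2)))
    (fun x => (-(2 * π * ω.1)) • (qI * (expI (-(2 * π * x.1 * ω.1)) * h x *
      expJ (-(2 * π * x.2 * ω.2)))) + expI (-(2 * π * x.1 * ω.1)) * h' x * expJ (-(2 * π * x.2 * ω.2)))
    (1, 0) i1 (i3.add i2) (fun x => by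
      have hx := hd x
      unfold HasLineDerivAt at hx ⊢
      have l : HasDerivAt (fun t : ℝ => -(2 * π * (x + t • ((1 : ℝ), (0 : ℝ))).1 * ω.1))
          (-(2 * π * ω.1)) 0 := by
        have := (((hasDerivAt_id (0 : ℝ)).const_add x.1).const_mul (2 * π)).mul_const ω.1 |>.fun_neg
        simpa using this
      have E : HasDerivAt (fun t : ℝ => expI (-(2 * π * (x + t • ((1 : ℝ), (0 : ℝ))).1 * ω.1))) _ 0 :=
        HasDerivAt.scomp (0 : ℝ) (expI_deriv _) l
      have P := (E.fun_mul hx).mul_const (expJ (-(2 * π * x.2 * ω.2)))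
      have fe : (fun t : ℝ => expI (-(2 * π * (x + t • ((1 : ℝ), (0 : ℝ))).1 * ω.1)) *
          h (x + t • ((1 : ℝ), (0 : ℝ))) * expJ (-(2 * π * (x + t • ((1 : ℝ), (0 : ℝ))).2 * ω.2))) =
          fun t : ℝ => expI (-(2 * π * (x + t • ((1 : ℝ), (0 : ℝ))).1 * ω.1)) *
          h (x + t • ((1 : ℝ), (0 : ℝ))) * expJ (-(2 * π * x.2 * ω.2)) := by
        funext t; simp
      rw [fe]
      refine P.congr_deriv ?_
      simp [add_mul, mul_assoc])
  rw [integral_add i3 i2, integral_smul, integral_const_mul_of_integrable i1] at z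
  change (-(2 * π * ω.1)) • (qI * QFT h ω) + QFT h' ω = 0 at z
  rw [eq_neg_of_add_eq_zero_right z, norm_neg, norm_smul, norm_mul, qI_norm, norm_neg, norm_mul,
    norm_mul]
  simp [abs_of_pos Real.pi_pos]

lemma ibp2 (h h' : ℝ × ℝ → Quaternion ℝ) (hc : Continuous h) (hi : Integrable h)
    (hc' : Continuous h') (hi' : Integrable h') (hd : ∀ x, HasLineDerivAt ℝ h (h' x) x (0, 1))
    (ω : ℝ × ℝ) : 2 * π * |ω.2| * ‖QFT h ω‖ = ‖QFT h' ω‖ := by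
  have i1 := phase_integrable h hc hi ω
  have i2 := phase_integrable h' hc' hi' ω
  have i3 : Integrable (fun x : ℝ × ℝ => (-(2 * π * ω.2)) • (
      (expI (-(2 * π * x.1 * ω.1)) * h x * expJ (-(2 * π * x.2 * ω.2))) * qJ)) :=
    (i1.mul_const qJ).smul (-(2 * π * ω.2))
  have z := int_lineDeriv_zero
    (fun x => expI (-(2 * π * x.1 * ω.1)) * h x * expJ (-(2 * π * x.2 * ω.2)))
    (fun x => (-(2 * π * ω.2)) • ((expI (-(2 * π * x.1 * ω.1)) * h x *
      expJ (-(2 * π * x.2 * ω.2))) * qJ) + expI (-(2 * π * x.1 * ω.1)) * h' x * expJ (-(2 * π * x.2 * ω.2)))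
    (0, 1) i1 (i3.add i2) (fun x => by
      have hx := hd x
      unfold HasLineDerivAt at hx ⊢
      have l : HasDerivAt (fun t : ℝ => -(2 * π * (x + t • ((0 : ℝ), (1 : ℝ))).2 * ω.2))
          (-(2 * π * ω.2)) 0 := by
        have := (((hasDerivAt_id (0 : ℝ)).const_add x.2).const_mul (2 * π)).mul_const ω.2 |>.fun_neg
        simpa using this
      have E : HasDerivAt (fun t : ℝ => expJ (-(2 * π * (x + t • ((0 : ℝ), (1 : ℝ))).2 * ω.2))) _ 0 :=
        HasDerivAt.scomp (0 : ℝ) (expJ_deriv _) l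
      have P := (hx.const_mul (expI (-(2 * π * x.1 * ω.1)))).fun_mul E
      have fe : (fun t : ℝ => expI (-(2 * π * (x + t • ((0 : ℝ), (1 : ℝ))).1 * ω.1)) *
          h (x + t • ((0 : ℝ), (1 : ℝ))) * expJ (-(2 * π * (x + t • ((0 : ℝ), (1 : ℝ))).2 * ω.2))) =
          fun t : ℝ => expI (-(2 * π * x.1 * ω.1)) *
          h (x + t • ((0 : ℝ), (1 : ℝ))) * expJ (-(2 * π * (x + t • ((0 : ℝ), (1 : ℝ))).2 * ω.2)) := by
        funext t; simp
      rw [fe]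
      refine P.congr_deriv ?_
      simp [mul_assoc, add_comm])
  rw [integral_add i3 i2, integral_smul, integral_mul_const_of_integrable i1] at z
  change (-(2 * π * ω.2)) • (QFT h ω * qJ) + QFT h' ω = 0 at z
  rw [eq_neg_of_add_eq_zero_right z, norm_neg, norm_smul, norm_mul, qJ_norm, norm_neg, norm_mul,
    norm_mul]
  simp [abs_of_pos Real.pi_pos]

lemma schw (A : SchwartzMap (ℝ × ℝ) (Quaternion ℝ)) (k : ℕ) :
    ∃ C : ℝ, 0 ≤ C ∧ ∀ x, (1 + ‖x‖) ^ k * ‖A x‖ ≤ C := by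
  have h : ∀ x, (1 + ‖x‖) ^ k * ‖A x‖ ≤ _ := fun x => by
    simpa using SchwartzMap.one_add_le_sup_seminorm_apply (𝕜 := ℝ) (m := (k, 0)) (k := k) (n := 0)
      le_rfl le_rfl A x
  exact ⟨_, (by positivity : (0 : ℝ) ≤ (1 + ‖(0 : ℝ × ℝ)‖) ^ k * ‖A 0‖).trans (h 0), h⟩

/-- The windowed function. -/
def wf (B A : SchwartzMap (ℝ × ℝ) (Quaternion ℝ)) (b x : ℝ × ℝ) : Quaternion ℝ := A x * star (B (x - b))

lemma GQFT_wf (B A : SchwartzMap (ℝ × ℝ) (Quaternion ℝ)) (ω b : ℝ × ℝ) :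
    GQFT B A ω b = QFT (wf B A b) ω := rfl

lemma wf_norm (B A : SchwartzMap (ℝ × ℝ) (Quaternion ℝ)) (b x : ℝ × ℝ) :
    ‖wf B A b x‖ = ‖A x‖ * ‖B (x - b)‖ := by
  unfold wf; rw [norm_mul, norm_star]

lemma wf_cont (B A : SchwartzMap (ℝ × ℝ) (Quaternion ℝ)) (b : ℝ × ℝ) : Continuous (wf B A b) := by
  have h1 := A.continuous
  have h2 := B.continuous
  unfold wf
  fun_prop

lemma peetre (x b : ℝ × ℝ) : 1 + ‖b‖ ≤ (1 + ‖x‖) * (1 + ‖x - b‖) := by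
  have h : ‖b‖ ≤ ‖x‖ + ‖x - b‖ := by
    have := norm_sub_le x (x - b); simpa using this
  nlinarith [norm_nonneg x, norm_nonneg (x - b)]

lemma wf_decay (B A : SchwartzMap (ℝ × ℝ) (Quaternion ℝ)) :
    ∃ C : ℝ, 0 ≤ C ∧ ∀ b x, (1 + ‖b‖) ^ 4 * ‖wf B A b x‖ ≤ C * (1 + ‖x‖) ^ (-4 : ℝ) := by
  obtain ⟨C1, h1, hA⟩ := schw A 8
  obtain ⟨C2, h2, hB⟩ := schw B 4
  refine ⟨C1 * C2, mul_nonneg h1 h2, fun b x => ?_⟩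
  have hp : 0 < (1 + ‖x‖) := by positivity
  have e : (1 + ‖x‖) ^ (-4 : ℝ) = ((1 + ‖x‖) ^ 4)⁻¹ := by
    rw [Real.rpow_neg hp.le]; norm_cast
  rw [e, ← div_eq_mul_inv, le_div_iff₀ (by positivity), wf_norm]
  have h3 := pow_le_pow_left₀ (by positivity) (peetre x b) 4
  calc (1 + ‖b‖) ^ 4 * (‖A x‖ * ‖B (x - b)‖) * (1 + ‖x‖) ^ 4
      ≤ ((1 + ‖x‖) * (1 + ‖x - b‖)) ^ 4 * (‖A x‖ * ‖B (x - b)‖) * (1 + ‖x‖) ^ 4 := by gcongr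
    _ = ((1 + ‖x‖) ^ 8 * ‖A x‖) * ((1 + ‖x - b‖) ^ 4 * ‖B (x - b)‖) := by ring
    _ ≤ _ := mul_le_mul (hA x) (hB _) (by positivity) h1

lemma wf_decay' (B A : SchwartzMap (ℝ × ℝ) (Quaternion ℝ)) :
    ∃ C : ℝ, 0 ≤ C ∧ ∀ b x, ‖wf B A b x‖ ≤ C * (1 + ‖x‖) ^ (-4 : ℝ) := by
  obtain ⟨C, h, hA⟩ := wf_decay B A
  refine ⟨C, h, fun b x => le_trans ?_ (hA b x)⟩
  have : 1 ≤ (1 + ‖b‖) ^ 4 := one_le_pow₀ (by linarith [norm_nonneg b])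
  nlinarith [norm_nonneg (wf B A b x)]

lemma wf_int (B A : SchwartzMap (ℝ × ℝ) (Quaternion ℝ)) (b : ℝ × ℝ) : Integrable (wf B A b) := by
  obtain ⟨C, h, hA⟩ := wf_decay' B A
  refine ((W_int 4 (by norm_num)).const_mul C).mono' (wf_cont B A b).aestronglyMeasurable ?_
  filter_upwards with x using hA b x

lemma G0 (B A : SchwartzMap (ℝ × ℝ) (Quaternion ℝ)) :
    ∃ C : ℝ, ∀ ω b, (1 + ‖b‖) ^ 4 * ‖QFT (wf B A b) ω‖ ≤ C := by
  obtain ⟨C, h, hA⟩ := wf_decay B A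
  refine ⟨∫ x : ℝ × ℝ, C * (1 + ‖x‖) ^ (-4 : ℝ), fun ω b => ?_⟩
  calc (1 + ‖b‖) ^ 4 * ‖QFT (wf B A b) ω‖ ≤ (1 + ‖b‖) ^ 4 * ∫ x, ‖wf B A b x‖ := by
        gcongr; exact QFT_bound _ _
    _ = ∫ x, (1 + ‖b‖) ^ 4 * ‖wf B A b x‖ := by rw [integral_const_mul]
    _ ≤ _ := integral_mono ((wf_int B A b).norm.const_mul _) ((W_int 4 (by norm_num)).const_mul C)
        (fun x => hA b x)

/-- Directional derivative of a Schwartz function. -/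
def sd (v : ℝ × ℝ) (A : SchwartzMap (ℝ × ℝ) (Quaternion ℝ)) : SchwartzMap (ℝ × ℝ) (Quaternion ℝ) :=
  LineDeriv.lineDerivOp v A

lemma sd_has (v : ℝ × ℝ) (A : SchwartzMap (ℝ × ℝ) (Quaternion ℝ)) (x : ℝ × ℝ) :
    HasLineDerivAt ℝ A (sd v A x) x v := by
  have : sd v A x = fderiv ℝ A x v := SchwartzMap.lineDerivOp_apply_eq_fderiv v A x
  rw [this]
  exact (A.hasFDerivAt x).hasLineDerivAt v

lemma wf_has (v : ℝ × ℝ) (B A : SchwartzMap (ℝ × ℝ) (Quaternion ℝ)) (b x : ℝ × ℝ) :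
    HasLineDerivAt ℝ (wf B A b) (wf B (sd v A) b x + wf (sd v B) A b x) x v := by
  have h1 := sd_has v A x
  have h2 := sd_has v B (x - b)
  unfold HasLineDerivAt at h1 h2 ⊢
  have : StarModule ℝ (Quaternion ℝ) := ⟨fun r q => by ext <;> simp⟩
  have h3 := HasDerivAt.star h2
  have P := h1.fun_mul h3
  have fe : (fun t : ℝ => wf B A b (x + t • v)) =
      fun t : ℝ => A (x + t • v) * star (B (x - b + t • v)) := by
    funext t; unfold wf; rw [show x + t • v - b = x - b + t • v by abel]
  rw [fe]
  refine P.congr_deriv ?_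
  simp [wf]

lemma QFT_add (h g : ℝ × ℝ → Quaternion ℝ) (hc : Continuous h) (hi : Integrable h)
    (hc' : Continuous g) (hi' : Integrable g) (ω : ℝ × ℝ) :
    QFT (fun x => h x + g x) ω = QFT h ω + QFT g ω := by
  unfold QFT
  rw [← integral_add (phase_integrable h hc hi ω) (phase_integrable g hc' hi' ω)]
  congr 1; ext1 x; simp only [mul_add, add_mul]

lemma step (k : Fin 2) (B A : SchwartzMap (ℝ × ℝ) (Quaternion ℝ)) (ω b : ℝ × ℝ) :
    |coord k ω| * ‖QFT (wf B A b) ω‖ ≤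
      ‖QFT (wf B (sd (dirv k) A) b) ω‖ + ‖QFT (wf (sd (dirv k) B) A b) ω‖ := by
  have e : 2 * π * |coord k ω| * ‖QFT (wf B A b) ω‖ =
      ‖QFT (fun x => wf B (sd (dirv k) A) b x + wf (sd (dirv k) B) A b x) ω‖ := by
    have c1 := wf_cont B (sd (dirv k) A) b
    have c2 := wf_cont (sd (dirv k) B) A b
    have i := (wf_int B (sd (dirv k) A) b).add (wf_int (sd (dirv k) B) A b)
    have d := wf_has (dirv k) B A b
    fin_cases k
    · exact ibp1 _ _ (wf_cont B A b) (wf_int B A b) (c1.add c2) i d ω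
    · exact ibp2 _ _ (wf_cont B A b) (wf_int B A b) (c1.add c2) i d ω
  rw [QFT_add _ _ (wf_cont _ _ b) (wf_int _ _ b) (wf_cont _ _ b) (wf_int _ _ b)] at e
  have := norm_add_le (QFT (wf B (sd (dirv k) A) b) ω) (QFT (wf (sd (dirv k) B) A b) ω)
  have h0 : 0 ≤ |coord k ω| * ‖QFT (wf B A b) ω‖ := by positivity
  nlinarith [Real.pi_gt_three]

lemma stepC (k : Fin 2) (n : ℕ) (H : ∀ B A : SchwartzMap (ℝ × ℝ) (Quaternion ℝ),
      ∃ C : ℝ, ∀ ω b, |coord k ω| ^ n * ((1 + ‖b‖) ^ 4 * ‖QFT (wf B A b) ω‖) ≤ C)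
    (B A : SchwartzMap (ℝ × ℝ) (Quaternion ℝ)) :
    ∃ C : ℝ, ∀ ω b, |coord k ω| ^ (n + 1) * ((1 + ‖b‖) ^ 4 * ‖QFT (wf B A b) ω‖) ≤ C := by
  obtain ⟨C1, h1⟩ := H B (sd (dirv k) A)
  obtain ⟨C2, h2⟩ := H (sd (dirv k) B) A
  refine ⟨C1 + C2, fun ω b => ?_⟩
  have hs := mul_le_mul_of_nonneg_left (step k B A ω b)
    (by positivity : 0 ≤ |coord k ω| ^ n * (1 + ‖b‖) ^ 4)
  have := h1 ω b
  have := h2 ω b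
  rw [pow_succ]
  linarith

lemma G2 (B A : SchwartzMap (ℝ × ℝ) (Quaternion ℝ)) :
    ∃ C : ℝ, ∀ ω b, (1 + ‖b‖) ^ 4 * ‖QFT (wf B A b) ω‖ ≤ C * (1 + ‖ω‖) ^ (-2 : ℝ) := by
  have H0 : ∀ k : Fin 2, ∀ B A : SchwartzMap (ℝ × ℝ) (Quaternion ℝ),
      ∃ C : ℝ, ∀ ω b, |coord k ω| ^ 0 * ((1 + ‖b‖) ^ 4 * ‖QFT (wf B A b) ω‖) ≤ C := by
    intro k B A; simpa using G0 B A
  obtain ⟨C0, h0⟩ := G0 B A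
  obtain ⟨C1, h1⟩ := stepC 0 1 (stepC 0 0 (H0 0)) B A
  obtain ⟨C2, h2⟩ := stepC 1 1 (stepC 1 0 (H0 1)) B A
  refine ⟨2 * C0 + 2 * C1 + 2 * C2, fun ω b => ?_⟩
  have hp : 0 < (1 + ‖ω‖) := by positivity
  have e : (1 + ‖ω‖) ^ (-2 : ℝ) = ((1 + ‖ω‖) ^ 2)⁻¹ := by
    rw [Real.rpow_neg hp.le]; norm_cast
  rw [e, ← div_eq_mul_inv, le_div_iff₀ (by positivity)]
  have a0 := h0 ω b
  have a1 := h1 ω b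
  have a2 := h2 ω b
  set Y := (1 + ‖b‖) ^ 4 * ‖QFT (wf B A b) ω‖ with hY
  have hY0 : 0 ≤ Y := by positivity
  simp only [coord, Nat.reduceAdd, sq_abs] at a1 a2
  have hn : ‖ω‖ ^ 2 ≤ ω.1 ^ 2 + ω.2 ^ 2 := by
    rw [Prod.norm_def, Real.norm_eq_abs, Real.norm_eq_abs]
    rcases max_choice |ω.1| |ω.2| with h | h <;> rw [h, sq_abs] <;> nlinarith [sq_nonneg ω.1, sq_nonneg ω.2]
  have hq : (1 + ‖ω‖) ^ 2 ≤ 2 + 2 * (ω.1 ^ 2 + ω.2 ^ 2) := by nlinarith [sq_nonneg (1 - ‖ω‖)]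
  have := mul_le_mul_of_nonneg_left hq hY0
  linarith

lemma fub (F P : ℝ × ℝ → ℝ) (hF : Integrable F) (hP : Integrable P) (hPc : Continuous P) :
    Integrable (fun b : ℝ × ℝ => ∫ x, F x * P (x - b)) ∧
      ∫ b : ℝ × ℝ, ∫ x, F x * P (x - b) = (∫ x, P x) * ∫ x, F x := by
  have hi : Integrable (Function.uncurry fun (b x : ℝ × ℝ) => F x * P (x - b))
      ((volume : Measure (ℝ × ℝ)).prod (volume : Measure (ℝ × ℝ))) := by
    have m : AEStronglyMeasurable (Function.uncurry fun (b x : ℝ × ℝ) => F x * P (x - b))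
        ((volume : Measure (ℝ × ℝ)).prod (volume : Measure (ℝ × ℝ))) := by
      refine AEStronglyMeasurable.mul (hF.1.comp_snd) ?_
      exact Continuous.aestronglyMeasurable (by fun_prop)
    rw [integrable_prod_iff' m]
    constructor
    · filter_upwards with x
      exact (hP.comp_sub_left x).const_mul (F x)
    · have e : (fun x : ℝ × ℝ => ∫ b : ℝ × ℝ,
          ‖Function.uncurry (fun (b x : ℝ × ℝ) => F x * P (x - b)) (b, x)‖) =
          fun x => ‖F x‖ * ∫ b, ‖P b‖ := by
        funext x
        simp only [Function.uncurry, norm_mul]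
        rw [integral_const_mul, integral_sub_left_eq_self (fun y => ‖P y‖) volume x]
      rw [e]
      exact hF.norm.mul_const _
  refine ⟨hi.integral_prod_left, ?_⟩
  rw [integral_integral_swap hi]
  simp only [integral_const_mul, integral_sub_left_eq_self P volume]
  rw [integral_mul_const]; ring

lemma G_cont (B A : SchwartzMap (ℝ × ℝ) (Quaternion ℝ)) :
    Continuous (fun p : (ℝ × ℝ) × (ℝ × ℝ) => QFT (wf B A p.1) p.2) := by
  obtain ⟨C, h, hA⟩ := wf_decay' B A
  have c1 := expI_cont
  have c2 := expJ_cont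
  have hB := B.continuous
  refine continuous_of_dominated (bound := fun x => C * (1 + ‖x‖) ^ (-4 : ℝ)) ?_ ?_
    ((W_int 4 (by norm_num)).const_mul C) ?_
  · intro p
    exact (phase_integrable _ (wf_cont B A p.1) (wf_int B A p.1) p.2).1
  · intro p
    filter_upwards with x
    simpa [expI_norm, expJ_norm] using hA p.1 x
  · filter_upwards with x
    unfold wf
    fun_prop

lemma Phi_int (B A : SchwartzMap (ℝ × ℝ) (Quaternion ℝ)) :
    Integrable (fun b : ℝ × ℝ => ∫ ω, Real.log (euclNorm ω) * ‖QFT (wf B A b) ω‖ ^ 2) := by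
  obtain ⟨C, hC⟩ := G2 B A
  have hi : Integrable (fun p : (ℝ × ℝ) × (ℝ × ℝ) =>
      Real.log (euclNorm p.2) * ‖QFT (wf B A p.1) p.2‖ ^ 2)
      ((volume : Measure (ℝ × ℝ)).prod (volume : Measure (ℝ × ℝ))) := by
    have hd : Integrable (fun p : (ℝ × ℝ) × (ℝ × ℝ) => (C ^ 2 * (1 + ‖p.1‖) ^ (-8 : ℝ)) *
        ‖Real.log (N2 p.2) * (1 + ‖p.2‖) ^ (-4 : ℝ)‖)
        ((volume : Measure (ℝ × ℝ)).prod (volume : Measure (ℝ × ℝ))) :=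
      ((W_int 8 (by norm_num)).const_mul (C ^ 2)).mul_prod log_weight.norm
    refine hd.mono' ?_ ?_
    · refine AEStronglyMeasurable.mul ?_ ((G_cont B A).norm.pow 2).aestronglyMeasurable
      apply Measurable.aestronglyMeasurable
      simp only [log_euclNorm]
      have := Real.measurable_log
      have := N2_meas
      fun_prop
    · filter_upwards with p
      obtain ⟨b, ω⟩ := p
      simp only [log_euclNorm]
      have hb : 0 < 1 + ‖b‖ := by positivity
      have hw : 0 < (1 + ‖ω‖) ^ (-4 : ℝ) := by positivity
      have h1 := hC ω b
      have h2 := sq_bound _ C 2 ω (by positivity) h1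
      have e : (1 + ‖b‖) ^ (-8 : ℝ) = ((1 + ‖b‖) ^ 8)⁻¹ := by
        rw [Real.rpow_neg hb.le]; norm_cast
      rw [show (-(2 * 2) : ℝ) = -4 by norm_num] at h2
      have h3 : ‖QFT (wf B A b) ω‖ ^ 2 ≤ C ^ 2 * (1 + ‖b‖) ^ (-8 : ℝ) * (1 + ‖ω‖) ^ (-4 : ℝ) := by
        have h4 : (1 + ‖b‖) ^ 8 * ‖QFT (wf B A b) ω‖ ^ 2 ≤ C ^ 2 * (1 + ‖ω‖) ^ (-4 : ℝ) := by
          calc _ = ((1 + ‖b‖) ^ 4 * ‖QFT (wf B A b) ω‖) ^ 2 := by ring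
            _ ≤ _ := h2
        rw [e, mul_right_comm, ← div_eq_mul_inv, le_div_iff₀ (by positivity)]
        linarith
      rw [norm_mul, norm_mul, norm_mul, Real.norm_of_nonneg hw.le,
        Real.norm_of_nonneg (sq_nonneg ‖QFT (wf B A b) ω‖)]
      have hl := norm_nonneg (Real.log (N2 ω))
      have h5 := mul_le_mul_of_nonneg_left h3 hl
      have h6 : 0 ≤ ‖Real.log (N2 ω)‖ * ‖QFT (wf B A b) ω‖ ^ 2 := by positivity
      have h7 : ‖(1 / 2 : ℝ)‖ = 1 / 2 := by norm_num
      rw [h7]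
      nlinarith
  exact hi.integral_prod_left

lemma schw_sq (A : SchwartzMap (ℝ × ℝ) (Quaternion ℝ)) :
    ∃ C : ℝ, ∀ x, ‖A x‖ ^ 2 ≤ C * (1 + ‖x‖) ^ (-4 : ℝ) := by
  obtain ⟨C, h, hA⟩ := schw A 2
  refine ⟨C ^ 2, fun x => ?_⟩
  have hp : 0 < (1 + ‖x‖) := by positivity
  have e : (1 + ‖x‖) ^ (-4 : ℝ) = ((1 + ‖x‖) ^ 4)⁻¹ := by
    rw [Real.rpow_neg hp.le]; norm_cast
  rw [e, ← div_eq_mul_inv, le_div_iff₀ (by positivity)]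
  calc _ = ((1 + ‖x‖) ^ 2 * ‖A x‖) ^ 2 := by ring
    _ ≤ _ := pow_le_pow_left₀ (by positivity) (hA x) 2

lemma sq_int (A : SchwartzMap (ℝ × ℝ) (Quaternion ℝ)) : Integrable (fun x => ‖A x‖ ^ 2) := by
  obtain ⟨C, h⟩ := schw_sq A
  refine ((W_int 4 (by norm_num)).const_mul C).mono' (A.continuous.norm.pow 2).aestronglyMeasurable ?_
  filter_upwards with x
  rw [Real.norm_of_nonneg (by positivity)]; exact h x

lemma log_sq_int (A : SchwartzMap (ℝ × ℝ) (Quaternion ℝ)) :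
    Integrable (fun x => Real.log (euclNorm x) * ‖A x‖ ^ 2) := by
  obtain ⟨C, h⟩ := schw_sq A
  simp only [log_euclNorm, mul_assoc]
  refine (log_mul_integrable _ (A.continuous.norm.pow 2).aestronglyMeasurable C fun x => ?_).const_mul _
  exact (abs_of_nonneg (sq_nonneg ‖A x‖)).trans_le (h x)


/-- **Logarithmic uncertainty principle for the GQFT.** For Schwartz `φ ≠ 0` and `f`,
`‖φ‖₂² ∫ ln|x| |f|² dx + ∫∫ ln|ω| |G_φ f(ω,b)|² dω db
  ≥ ‖φ‖₂² (Γ'(1/2)/Γ(1/2) - ln π) ∫ |f|² dx`. -/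
theorem gqft_log_uncertainty (φ f : SchwartzMap (ℝ × ℝ) (Quaternion ℝ)) (hφ0 : φ ≠ 0) :
    (∫ x : ℝ × ℝ, ‖φ x‖ ^ 2) * (∫ x : ℝ × ℝ, Real.log (euclNorm x) * ‖f x‖ ^ 2) +
      (∫ b : ℝ × ℝ, ∫ ω : ℝ × ℝ, Real.log (euclNorm ω) * ‖GQFT (⇑φ) (⇑f) ω b‖ ^ 2) ≥
      (∫ x : ℝ × ℝ, ‖φ x‖ ^ 2) *
        ((deriv Real.Gamma (1 / 2) / Real.Gamma (1 / 2) - Real.log π) *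
          ∫ x : ℝ × ℝ, ‖f x‖ ^ 2) := by
  obtain ⟨C, _, hC⟩ := wf_decay' φ f
  obtain ⟨C', hC'⟩ := G2 φ f
  have pw : ∀ b : ℝ × ℝ, (deriv Real.Gamma (1 / 2) / Real.Gamma (1 / 2) - Real.log π) *
      (∫ x, ‖f x‖ ^ 2 * ‖φ (x - b)‖ ^ 2) ≤
      (∫ x, Real.log (euclNorm x) * ‖f x‖ ^ 2 * ‖φ (x - b)‖ ^ 2) +
        ∫ ω, Real.log (euclNorm ω) * ‖QFT (wf φ f b) ω‖ ^ 2 := by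
    intro b
    have h := log_qft (wf φ f b) (wf_cont φ f b) C C' (hC b) (fun ω => by
      refine le_trans ?_ (hC' ω b)
      have : 1 ≤ (1 + ‖b‖) ^ 4 := one_le_pow₀ (by linarith [norm_nonneg b])
      nlinarith [norm_nonneg (QFT (wf φ f b) ω)])
    simpa only [wf_norm, mul_pow, mul_assoc] using h
  have hPc : Continuous (fun x => ‖φ x‖ ^ 2) := φ.continuous.norm.pow 2
  obtain ⟨i1, e1⟩ := fub _ _ (sq_int f) (sq_int φ) hPc
  obtain ⟨i2, e2⟩ := fub _ _ (log_sq_int f) (sq_int φ) hPc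
  have i3 := Phi_int φ f
  have h := integral_mono (i1.const_mul (deriv Real.Gamma (1 / 2) / Real.Gamma (1 / 2) - Real.log π))
    (i2.add i3) pw
  rw [integral_const_mul, integral_add' i2 i3, e1, e2] at h
  simp only [GQFT_wf]
  linarith
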